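/- The Belavin R-matrix satisfies the crossing-unitarity relation: for generic ξ ∈ ℂ, assuming R(z)^{t₂} and R(q^N z) are invertible, (R(z)^{t₂})^{−1} = (R(q^N z)^{−1})^{t₂}, where t₂ denotes partial transposition in the second tensor factor and the argument q^N z corresponds to ξ + Nζ. -/

import Mathlib

open Complex Matrix Kronecker

noncomputable section

/-- `eπ x = exp(iπx)`; the variables `z, q, p` of the paper are `eπ ξ, eπ ζ, eπ (2τ)`. -/
def eπ (x : ℂ) : ℂ := Complex.exp (Real.pi * Complex.I * x)

/-- Jacobi theta function with characteristics `ϑ[γ₁,γ₂](u,τ)`. -/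
def jTheta (γ₁ γ₂ : ℝ) (u τ : ℂ) : ℂ :=
  ∑' m : ℤ, Complex.exp (Real.pi * Complex.I * ((m : ℂ) + (γ₁ : ℂ)) ^ 2 * τ +
    2 * Real.pi * Complex.I * ((m : ℂ) + (γ₁ : ℂ)) * (u + (γ₂ : ℂ)))

/-- single infinite Pochhammer symbol `(x;s)_∞`. -/
def poch1 (x s : ℂ) : ℂ := ∏' n : ℕ, (1 - x * s ^ n)

/-- double infinite Pochhammer symbol `(x;p₁,p₂)_∞`. -/
def poch2 (x p₁ p₂ : ℂ) : ℂ := ∏' n : ℕ × ℕ, (1 - x * p₁ ^ n.1 * p₂ ^ n.2)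

/-- Jacobi `Θ_s(x)` function. -/
def ThetaF (s x : ℂ) : ℂ := poch1 x s * poch1 (s * x⁻¹) s * poch1 s s

/-- numerator of `1/κ(z²)`, with `z = eπ ξ`, `q = eπ ζ`, `p = eπ (2τ)`. -/
def kappaNum (N : ℕ) (ξ ζ τ : ℂ) : ℂ :=
  poch2 (eπ (2 * N * ζ - 2 * ξ)) (eπ (2 * τ)) (eπ (2 * N * ζ)) *
  poch2 (eπ (2 * ζ + 2 * ξ)) (eπ (2 * τ)) (eπ (2 * N * ζ)) *
  poch2 (eπ (2 * τ - 2 * ξ)) (eπ (2 * τ)) (eπ (2 * N * ζ)) *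
  poch2 (eπ (2 * τ + (2 * N - 2) * ζ + 2 * ξ)) (eπ (2 * τ)) (eπ (2 * N * ζ))

/-- denominator of `1/κ(z²)`: the numerator with `ξ → -ξ`. -/
def kappaDen (N : ℕ) (ξ ζ τ : ℂ) : ℂ := kappaNum N (-ξ) ζ τ

/-- the diagonal matrix `g^{1/2}` with entries `e^{iπj/N}`, `1 ≤ j ≤ N`. -/
def gHalf (N : ℕ) : Matrix (Fin N) (Fin N) ℂ :=
  Matrix.diagonal fun j => eπ ((((j : ℕ) : ℂ) + 1) / N)

/-- the diagonal matrix `g` with entries `ω^j = e^{2iπj/N}`, `1 ≤ j ≤ N`. -/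
def gMat (N : ℕ) : Matrix (Fin N) (Fin N) ℂ :=
  Matrix.diagonal fun j => eπ (2 * (((j : ℕ) : ℂ) + 1) / N)

/-- the shift matrix `h`, `h_{jl} = δ_{j+1,l}` (mod `N`). -/
def hMat (N : ℕ) : Matrix (Fin N) (Fin N) ℂ :=
  Matrix.of fun j l => if (l : ℕ) = ((j : ℕ) + 1) % N then 1 else 0

/-- `I_{(α₁,α₂)} = g^{α₂} h^{α₁}`. -/
def Imat (N : ℕ) (α : Fin N × Fin N) : Matrix (Fin N) (Fin N) ℂ :=
  gMat N ^ (α.2 : ℕ) * hMat N ^ (α.1 : ℕ)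

/-- the coefficient `W_{(α₁,α₂)}(ξ,ζ,τ)`. -/
def Wcoef (N : ℕ) (α : Fin N × Fin N) (ξ ζ τ : ℂ) : ℂ :=
  jTheta (1/2 + (α.1 : ℕ) / N) (1/2 + (α.2 : ℕ) / N) (ξ + ζ / N) τ /
    (N * jTheta (1/2 + (α.1 : ℕ) / N) (1/2 + (α.2 : ℕ) / N) (ζ / N) τ)

/-- the matrix `𝒵(z)`, `z = eπ ξ`. -/
def Zmat (N : ℕ) (ξ ζ τ : ℂ) : Matrix (Fin N × Fin N) (Fin N × Fin N) ℂ :=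
  (eπ (ξ * (2 / N - 2)) * (kappaNum N ξ ζ τ / kappaDen N ξ ζ τ) *
      jTheta (1/2) (1/2) ζ τ / jTheta (1/2) (1/2) (ξ + ζ) τ) •
    ∑ α : Fin N × Fin N, Wcoef N α ξ ζ τ • (Imat N α ⊗ₖ (Imat N α)⁻¹)

/-- the Belavin R-matrix `R(z)`, as a function of `ξ` with `z = eπ ξ`. -/
def Rmat (N : ℕ) (ξ ζ τ : ℂ) : Matrix (Fin N × Fin N) (Fin N × Fin N) ℂ :=
  (gHalf N ⊗ₖ gHalf N) * Zmat N ξ ζ τ * (gHalf N ⊗ₖ gHalf N)⁻¹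

/-- genericity: every theta-function value and κ-value appearing in a denominator is nonzero. -/
def Rgeneric (N : ℕ) (ξ ζ τ : ℂ) : Prop :=
  jTheta (1/2) (1/2) (ξ + ζ) τ ≠ 0 ∧
  (∀ α : Fin N × Fin N,
    jTheta (1/2 + (α.1 : ℕ) / N) (1/2 + (α.2 : ℕ) / N) (ζ / N) τ ≠ 0) ∧
  kappaDen N ξ ζ τ ≠ 0

/-- the flip (permutation) operator `P` on `ℂ^N ⊗ ℂ^N`. -/
def Pflip (N : ℕ) : Matrix (Fin N × Fin N) (Fin N × Fin N) ℂ :=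
  Matrix.of fun a b => if a.1 = b.2 ∧ a.2 = b.1 then 1 else 0

/-- partial transposition in the second tensor factor. -/
def pt2 {N : ℕ} (M : Matrix (Fin N × Fin N) (Fin N × Fin N) ℂ) :
    Matrix (Fin N × Fin N) (Fin N × Fin N) ℂ :=
  Matrix.of fun a b => M (a.1, b.2) (b.1, a.2)

/-- `τ_N` evaluated at `eπ u` (all fractional powers via exponentials). -/
def tauNe (N : ℕ) (ζ u : ℂ) : ℂ :=
  eπ (u * (2 / N - 2)) * ThetaF (eπ (2 * N * ζ)) (eπ (ζ + 2 * u)) /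
    ThetaF (eπ (2 * N * ζ)) (eπ (ζ - 2 * u))

/-- the normalized Belavin R-matrix `R̂(z) = τ_N(q^{1/2}z⁻¹) R(z)`, as a function of `ξ`. -/
def Rhat (N : ℕ) (ξ ζ τ : ℂ) : Matrix (Fin N × Fin N) (Fin N × Fin N) ℂ :=
  tauNe N ζ (ζ / 2 - ξ) • Rmat N ξ ζ τ



/-- an entire function with nonzero multipliers along `1` and `τ` is an exponential -/
lemma quasi_const {τ : ℂ} (hτ : 0 < τ.im) {D : ℂ → ℂ} (hD : Differentiable ℂ D) {μ ν : ℂ}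
    (hμ : μ ≠ 0) (hν : ν ≠ 0) (h1 : ∀ y, D (y + 1) = μ * D y) (h2 : ∀ y, D (y + τ) = ν * D y) :
    ∃ K c : ℂ, ∀ y, D y = K * cexp (c * y) := by
  set r : ℝ := -Real.log ‖μ‖ with hr
  set c : ℂ := ⟨r, (r * τ.re + Real.log ‖ν‖) / τ.im⟩ with hc
  have e1 : ‖cexp c * μ‖ = 1 := by
    rw [norm_mul, Complex.norm_exp]
    have : c.re = r := rfl
    rw [this, hr, Real.exp_neg, Real.exp_log (norm_pos_iff.2 hμ)]
    exact inv_mul_cancel₀ (norm_ne_zero_iff.2 hμ)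
  have e2 : ‖cexp (c * τ) * ν‖ = 1 := by
    rw [norm_mul, Complex.norm_exp]
    have : (c * τ).re = -Real.log ‖ν‖ := by
      rw [Complex.mul_re]
      have a : c.re = r := rfl
      have b : c.im = (r * τ.re + Real.log ‖ν‖) / τ.im := rfl
      rw [a, b]; field_simp; ring
    rw [this, Real.exp_neg, Real.exp_log (norm_pos_iff.2 hν)]
    exact inv_mul_cancel₀ (norm_ne_zero_iff.2 hν)
  let G : ℂ → ℂ := fun y => D y * cexp (c * y)
  have hG : Differentiable ℂ G := by fun_prop
  have g1 : ∀ y, ‖G (y + 1)‖ = ‖G y‖ := by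
    intro y
    have : G (y + 1) = (cexp c * μ) * G y := by
      simp only [G, h1, mul_add, mul_one, Complex.exp_add]; ring
    rw [this, norm_mul, e1, one_mul]
  have g2 : ∀ y, ‖G (y + τ)‖ = ‖G y‖ := by
    intro y
    have : G (y + τ) = (cexp (c * τ) * ν) * G y := by
      simp only [G, h2, mul_add, Complex.exp_add]; ring
    rw [this, norm_mul, e2, one_mul]
  have g1z : ∀ (n : ℤ) y, ‖G (y + n)‖ = ‖G y‖ := by
    intro n
    induction n using Int.induction_on with
    | zero => simp
    | succ n ih =>
      intro y
      have := g1 (y + n)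
      rw [← ih y]; push_cast at *; rw [← this]; ring_nf
    | pred n ih =>
      intro y
      have := g1 (y + (-n - 1))
      rw [← ih y]; push_cast at *; rw [← this]; ring_nf
  have g2z : ∀ (n : ℤ) y, ‖G (y + n * τ)‖ = ‖G y‖ := by
    intro n
    induction n using Int.induction_on with
    | zero => simp
    | succ n ih =>
      intro y
      have := g2 (y + n * τ)
      rw [← ih y]; push_cast at *; rw [← this]; ring_nf
    | pred n ih =>
      intro y
      have := g2 (y + (-n - 1) * τ)
      rw [← ih y]; push_cast at *; rw [← this]; ring_nf
  obtain ⟨C, hC⟩ := (isCompact_closedBall (0 : ℂ) (1 + ‖τ‖)).exists_bound_of_continuousOn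
    (f := G) hG.continuous.continuousOn
  have bd : ∀ y, ‖G y‖ ≤ C := by
    intro y
    set n : ℤ := ⌊y.im / τ.im⌋ with hn
    set y' : ℂ := y - n * τ with hy'
    set m : ℤ := ⌊y'.re⌋ with hm
    have key : ‖G y‖ = ‖G (y' - m)‖ := by
      rw [← g1z m (y' - m), ← g2z n (y' - m + m)]; congr 2; rw [hy']; ring
    rw [key]
    apply hC
    rw [mem_closedBall_zero_iff]
    have hi : (y' - m).im = Int.fract (y.im / τ.im) * τ.im := by
      simp [hy', Int.fract, ← hn]; field_simp
    have hre : (y' - m).re = Int.fract y'.re := by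
      simp [Int.fract, ← hm]
    calc ‖y' - m‖ ≤ |(y' - m).re| + |(y' - m).im| := Complex.norm_le_abs_re_add_abs_im _
      _ ≤ 1 + ‖τ‖ := by
        rw [hi, hre, abs_mul, Int.abs_fract, Int.abs_fract]
        have a1 := (Int.fract_lt_one y'.re).le
        have a2 := (Int.fract_lt_one (y.im / τ.im)).le
        have a3 := Complex.abs_im_le_norm τ
        have a4 := abs_nonneg τ.im
        have a5 := Int.fract_nonneg (y.im / τ.im)
        nlinarith
  obtain ⟨K, hK⟩ := hG.exists_const_forall_eq_of_bounded
    ((Metric.isBounded_closedBall (x := (0:ℂ)) (r := C)).subset (by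
      rintro _ ⟨y, rfl⟩; simpa using bd y))
  refine ⟨K, -c, fun y => ?_⟩
  rw [← hK y]
  simp only [G, mul_assoc, ← Complex.exp_add]; simp

/-- division of an entire function by one with simple zeros -/
lemma exists_div {F G : ℂ → ℂ} (hF : Differentiable ℂ F) (hG : Differentiable ℂ G)
    (hs : ∀ u, G u = 0 → deriv G u ≠ 0) (hz : ∀ u, G u = 0 → F u = 0) :
    ∃ Q : ℂ → ℂ, Differentiable ℂ Q ∧ ∀ u, F u = Q u * G u := by
  classical
  let Q : ℂ → ℂ := fun u => if G u = 0 then deriv F u / deriv G u else F u / G u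
  have hQ0 : ∀ u, G u ≠ 0 → DifferentiableAt ℂ Q u := by
    intro u hu
    have : (fun v => F v / G v) =ᶠ[nhds u] Q := by
      filter_upwards [hG.continuous.continuousAt.eventually_ne hu] with v hv
      simp [Q, hv]
    exact ((hF u).div (hG u) hu).congr_of_eventuallyEq this.symm
  refine ⟨Q, fun u => ?_, fun u => ?_⟩
  · by_cases hu : G u = 0
    · have ev : ∀ᶠ v in nhdsWithin u {u}ᶜ, G v ≠ 0 := by
        have := (hG u).hasDerivAt.eventually_ne (c := 0) (hs u hu)
        exact this
      apply AnalyticAt.differentiableAt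
      apply analyticAt_of_differentiable_on_punctured_nhds_of_continuousAt
      · filter_upwards [ev] with v hv using hQ0 v hv
      · rw [continuousAt_iff_punctured_nhds]
        have sF := (hF u).hasDerivAt.tendsto_slope
        have sG := (hG u).hasDerivAt.tendsto_slope
        have := sF.div sG (hs u hu)
        have hq : Q u = deriv F u / deriv G u := by simp [Q, hu]
        rw [hq]
        refine this.congr' ?_
        filter_upwards [ev, self_mem_nhdsWithin] with v hv hvu
        have : v - u ≠ 0 := sub_ne_zero.2 hvu
        simp only [Q, hv, if_false, Pi.div_apply, slope_def_field, hu, hz u hu, sub_zero]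
        field_simp
    · exact hQ0 u hu
  · by_cases hu : G u = 0
    · simp [hu, hz u hu]
    · simp [Q, hu]

/-- continuous functions agreeing off the zeros of a nonzero entire function agree -/
lemma eq_of_eq_off_zeros {f g G : ℂ → ℂ} (hG : Differentiable ℂ G) (u0 : ℂ) (hu0 : G u0 ≠ 0)
    {v : ℂ} (hf : ContinuousAt f v) (hg : ContinuousAt g v)
    (h : ∀ᶠ u in nhdsWithin v {v}ᶜ, G u ≠ 0 → f u = g u) : f v = g v := by
  have an : AnalyticOnNhd ℂ G Set.univ := fun z _ => hG.analyticAt z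
  have ev : ∀ᶠ u in nhdsWithin v {v}ᶜ, G u ≠ 0 := by
    rcases (hG.analyticAt v).eventually_eq_zero_or_eventually_ne_zero with h0 | h0
    · exact absurd (an.eqOn_zero_of_preconnected_of_eventuallyEq_zero isPreconnected_univ
        (Set.mem_univ v) h0 (Set.mem_univ u0)) hu0
    · exact h0
  have := hf.mono_left (nhdsWithin_le_nhds (s := {v}ᶜ))
  refine tendsto_nhds_unique (this.congr' ?_) (hg.mono_left nhdsWithin_le_nhds)
  filter_upwards [ev, h] with u h1 h2 using h2 h1

lemma eπ_add (a b : ℂ) : eπ (a + b) = eπ a * eπ b := by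
  simp only [eπ, mul_add, Complex.exp_add]
lemma eπ_zero : eπ 0 = 1 := by simp [eπ]
lemma eπ_ne (a : ℂ) : eπ a ≠ 0 := Complex.exp_ne_zero _
lemma eπ_neg (a : ℂ) : eπ (-a) = (eπ a)⁻¹ := by
  simp only [eπ, mul_neg, Complex.exp_neg]
lemma eπ_sub (a b : ℂ) : eπ (a - b) = eπ a / eπ b := by
  rw [sub_eq_add_neg, eπ_add, eπ_neg, div_eq_mul_inv]
lemma eπ_one : eπ 1 = -1 := by simp [eπ]
lemma eπ_two : eπ 2 = 1 := by
  have : (2:ℂ) = 1 + 1 := by norm_num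
  rw [this, eπ_add, eπ_one]; norm_num
lemma eπ_nat_mul (n : ℕ) (a : ℂ) : eπ (n * a) = eπ a ^ n := by
  simp only [eπ]; rw [← Complex.exp_nat_mul]; congr 1; ring
lemma eπ_int_mul (n : ℤ) (a : ℂ) : eπ (n * a) = eπ a ^ n := by
  simp only [eπ]; rw [← Complex.exp_int_mul]; congr 1; ring
lemma eπ_two_int (n : ℤ) : eπ (2 * n) = 1 := by
  rw [mul_comm, eπ_int_mul, eπ_two]; simp
lemma eπ_two_mul_eq_one {a : ℂ} (h : eπ (2 * a) = 1) : ∃ n : ℤ, a = n := by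
  rw [eπ, Complex.exp_eq_one_iff] at h
  obtain ⟨n, hn⟩ := h
  refine ⟨n, ?_⟩
  have : (Real.pi : ℂ) * I ≠ 0 := by simp [Real.pi_ne_zero]
  apply mul_left_cancel₀ this
  apply mul_left_cancel₀ (two_ne_zero (α := ℂ))
  linear_combination hn
lemma norm_eπ (a : ℂ) : ‖eπ a‖ = Real.exp (-Real.pi * a.im) := by
  rw [eπ, Complex.norm_exp]; congr 1; simp
lemma norm_eπ_lt {a : ℂ} (h : 0 < a.im) : ‖eπ a‖ < 1 := by
  rw [norm_eπ, Real.exp_lt_one_iff]; have := Real.pi_pos; nlinarith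
@[fun_prop]
lemma eπ_diff : Differentiable ℂ eπ := by unfold eπ; fun_prop
@[fun_prop]
lemma eπ_cont : Continuous eπ := eπ_diff.continuous

/-- the odd theta function -/
def th (τ u : ℂ) : ℂ := jTheta (1/2) (1/2) u τ

lemma th_eq_jac (τ u : ℂ) :
    th τ u = eπ (τ / 4 + u + 1 / 2) * jacobiTheta₂ (u + 1 / 2 + τ / 2) τ := by
  rw [th, jTheta, jacobiTheta₂, ← tsum_mul_left]
  congr 1; ext m
  rw [jacobiTheta₂_term, eπ, ← Complex.exp_add]; congr 1
  push_cast; ring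

lemma jTheta_char (τ u : ℂ) (a b : ℝ) :
    jTheta (1/2 + a) (1/2 + b) u τ =
      eπ (a ^ 2 * τ + 2 * a * (u + 1 / 2 + b)) * th τ (u + a * τ + b) := by
  rw [th, jTheta, jTheta, ← tsum_mul_left]
  congr 1; ext m
  rw [eπ, ← Complex.exp_add]; congr 1
  push_cast; ring

lemma th_add_one (τ u : ℂ) : th τ (u + 1) = - th τ u := by
  rw [th_eq_jac, th_eq_jac]
  have : u + 1 + 1 / 2 + τ / 2 = (u + 1/2 + τ / 2) + 1 := by ring
  rw [this, jacobiTheta₂_add_left]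
  have : τ / 4 + (u + 1) + 1 / 2 = (τ / 4 + u + 1 / 2) + 1 := by ring
  rw [this, eπ_add, eπ_one]; ring

lemma th_add_tau (τ u : ℂ) : th τ (u + τ) = - eπ (-τ - 2 * u) * th τ u := by
  rw [th_eq_jac, th_eq_jac]
  have : u + τ + 1 / 2 + τ / 2 = (u + 1/2 + τ / 2) + τ := by ring
  rw [this, jacobiTheta₂_add_left']
  have e : cexp (-↑Real.pi * I * (τ + 2 * (u + 1 / 2 + τ / 2))) =
    eπ (-(2 * τ + 2 * u + 1)) := by rw [eπ]; congr 1; ring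
  have h1 : (-1 : ℂ) = eπ (-1) := by rw [eπ_neg, eπ_one]; norm_num
  rw [e, neg_mul, neg_eq_neg_one_mul (_ * _), h1]
  simp only [← mul_assoc, ← eπ_add]
  congr 2; ring

lemma th_neg (τ u : ℂ) : th τ (-u) = - th τ u := by
  rw [th_eq_jac, th_eq_jac]
  have : -u + 1 / 2 + τ / 2 = -(u - 1/2 - τ / 2) := by ring
  rw [this, jacobiTheta₂_neg_left]
  have h : jacobiTheta₂ (u + 1/2 + τ/2) τ = jacobiTheta₂ ((u - 1/2 - τ/2) + τ + 1) τ := by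
    congr 1; ring
  rw [h, jacobiTheta₂_add_left, jacobiTheta₂_add_left']
  have e : cexp (-↑Real.pi * I * (τ + 2 * (u - 1 / 2 - τ / 2))) =
    eπ (-(2 * u - 1)) := by rw [eπ]; congr 1; ring
  have h1 : (-1 : ℂ) = eπ (-1) := by rw [eπ_neg, eπ_one]; norm_num
  rw [e, neg_eq_neg_one_mul (eπ _ * _), h1, ← mul_assoc, ← mul_assoc, ← eπ_add, ← eπ_add]
  congr 2; ring

lemma th_zero (τ : ℂ) : th τ 0 = 0 := by
  have := th_neg τ 0
  rw [neg_zero] at this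
  exact CharZero.eq_neg_self_iff.1 this

lemma th_diff {τ : ℂ} (hτ : 0 < τ.im) : Differentiable ℂ (th τ) := by
  have : th τ = fun u => eπ (τ / 4 + u + 1 / 2) * jacobiTheta₂ (u + 1 / 2 + τ / 2) τ := by
    ext u; exact th_eq_jac τ u
  rw [this]
  intro u
  have h := differentiableAt_jacobiTheta₂_fst (u + 1 / 2 + τ / 2) hτ
  have h2 : DifferentiableAt ℂ (fun u => jacobiTheta₂ (u + 1 / 2 + τ / 2) τ) u :=
    DifferentiableAt.comp (g := fun z => jacobiTheta₂ z τ) u h (by fun_prop)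
  exact DifferentiableAt.mul (by fun_prop) h2

/- infinite products -/

lemma poch1_summable {s : ℂ} (hs : ‖s‖ < 1) (x : ℂ) : Summable fun n : ℕ => ‖-(x * s ^ n)‖ := by
  simp only [norm_neg, norm_mul, norm_pow]
  exact (summable_geometric_of_lt_one (norm_nonneg _) hs).mul_left _

lemma poch1_mult {s : ℂ} (hs : ‖s‖ < 1) (x : ℂ) : Multipliable fun n : ℕ => 1 - x * s ^ n := by
  simpa [sub_eq_add_neg] using multipliable_one_add_of_summable (poch1_summable hs x)

lemma poch1_succ {s : ℂ} (hs : ‖s‖ < 1) (x : ℂ) : poch1 x s = (1 - x) * poch1 (x * s) s := by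
  unfold poch1
  rw [tprod_eq_zero_mul']
  · simp [pow_succ', mul_assoc]
  · simpa [pow_succ', mul_assoc] using poch1_mult hs (x * s)

lemma poch1_ne_zero {s : ℂ} (hs : ‖s‖ < 1) {x : ℂ} (h : ∀ n : ℕ, x * s ^ n ≠ 1) :
    poch1 x s ≠ 0 := by
  have := tprod_one_add_ne_zero_of_summable (f := fun n : ℕ => -(x * s ^ n))
    (fun n => by rw [← sub_eq_add_neg, sub_ne_zero]; exact (h n).symm) (poch1_summable hs x)
  simpa [poch1, sub_eq_add_neg] using this

lemma poch1_diff {s : ℂ} (hs : ‖s‖ < 1) : Differentiable ℂ (fun x => poch1 x s) := by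
  have : HasProdLocallyUniformlyOn (fun (n : ℕ) (x : ℂ) => 1 + (-(x * s ^ n)))
      (fun x => ∏' n : ℕ, (1 + (-(x * s ^ n)))) Set.univ := by
    apply hasProdLocallyUniformlyOn_of_forall_compact isOpen_univ
    intro K hK hcK
    obtain ⟨C, hC⟩ := hcK.isBounded.exists_norm_le
    refine ((summable_geometric_of_lt_one (norm_nonneg _) hs).mul_left C).hasProdUniformlyOn_nat_one_add
      hcK (.of_forall fun n x hx ↦ ?_) (fun _ ↦ by fun_prop)
    rw [norm_neg, norm_mul, norm_pow]
    exact mul_le_mul_of_nonneg_right (hC x hx) (by positivity)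
  have h2 := this.differentiableOn
    (.of_forall fun _ ↦ by simpa [Finset.prod_fn] using
      DifferentiableOn.finsetProd (fun _ _ ↦ by fun_prop)) isOpen_univ
  rw [← differentiableOn_univ]
  simpa [poch1, sub_eq_add_neg] using h2

lemma poch2_mult {p s : ℂ} (hp : ‖p‖ < 1) (hs : ‖s‖ < 1) (x : ℂ) :
    Summable fun n : ℕ × ℕ => ‖-(x * p ^ n.1 * s ^ n.2)‖ := by
  have := (summable_geometric_of_lt_one (norm_nonneg _) hp).mul_of_nonneg
    (summable_geometric_of_lt_one (norm_nonneg _) hs) (fun _ => by positivity) (fun _ => by positivity)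
  simpa [mul_assoc] using this.mul_left ‖x‖

lemma poch2_succ {p s : ℂ} (hp : ‖p‖ < 1) (hs : ‖s‖ < 1) (x : ℂ) :
    poch2 x p s = poch1 x p * poch2 (x * s) p s := by
  have m' : Multipliable fun n : ℕ × ℕ => 1 - x * s * p ^ n.1 * s ^ n.2 := by
    simpa [sub_eq_add_neg] using multipliable_one_add_of_summable (poch2_mult hp hs (x * s))
  have m1 := (poch1_mult hp x).hasProd
  have i1 : Function.Injective (fun n : ℕ => ((n, 0) : ℕ × ℕ)) := fun a b h => by simpa using h
  have i2 : Function.Injective (fun n : ℕ × ℕ => ((n.1, n.2 + 1) : ℕ × ℕ)) := fun a b h => by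
    simp only [Prod.mk.injEq, add_left_inj] at h; exact Prod.ext h.1 h.2
  have k1 := (i1.hasProd_range_iff (f := fun n : ℕ × ℕ => 1 - x * p ^ n.1 * s ^ n.2)
    (a := poch1 x p)).2 (by simpa [Function.comp_def, poch1] using m1)
  have k2 := (i2.hasProd_range_iff (f := fun n : ℕ × ℕ => 1 - x * p ^ n.1 * s ^ n.2)
    (a := poch2 (x * s) p s)).2 (by
      have hm : HasProd (fun n : ℕ × ℕ => 1 - x * s * p ^ n.1 * s ^ n.2) (poch2 (x * s) p s) :=
        m'.hasProd
      have he : ((fun n : ℕ × ℕ => 1 - x * p ^ n.1 * s ^ n.2) ∘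
          fun n : ℕ × ℕ => ((n.1, n.2 + 1) : ℕ × ℕ)) =
          fun n : ℕ × ℕ => 1 - x * s * p ^ n.1 * s ^ n.2 := by
        funext n; simp only [Function.comp]; ring
      rw [he]; exact hm)
  suffices hc : IsCompl (Set.range (fun n : ℕ => ((n, 0) : ℕ × ℕ)))
      (Set.range (fun n : ℕ × ℕ => ((n.1, n.2 + 1) : ℕ × ℕ))) by
    exact HasProd.tprod_eq (HasProd.mul_isCompl (f := fun n : ℕ × ℕ => 1 - x * p ^ n.1 * s ^ n.2)
      hc k1 k2)
  rw [isCompl_iff, Set.disjoint_iff_inter_eq_empty, codisjoint_iff_le_sup]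
  constructor
  · ext ⟨a, b⟩
    simp only [Set.mem_inter_iff, Set.mem_range, Prod.mk.injEq, Prod.exists, Set.mem_empty_iff_false]
    rw [iff_false]
    rintro ⟨⟨c, -, h⟩, ⟨d, e, -, h'⟩⟩
    omega
  · rintro ⟨a, b⟩ -
    rcases b with _ | b
    · left; exact ⟨a, rfl⟩
    · right; exact ⟨(a, b), rfl⟩

lemma pred_shift {τ : ℂ} {Q : ℂ → Prop} (h1 : ∀ u, Q (u + 1) ↔ Q u) (h2 : ∀ u, Q (u + τ) ↔ Q u)
    (m n : ℤ) (u : ℂ) : Q (u + m + n * τ) ↔ Q u := by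
  have a1 : ∀ (n : ℤ) y, Q (y + n) ↔ Q y := by
    intro n
    induction n using Int.induction_on with
    | zero => simp
    | succ n ih =>
      intro y
      have := h1 (y + n)
      rw [← ih y]; push_cast at *; rw [← this]; ring_nf
    | pred n ih =>
      intro y
      have := h1 (y + (-n - 1))
      rw [← ih y]; push_cast at *; rw [← this]; ring_nf
  have a2 : ∀ (n : ℤ) y, Q (y + n * τ) ↔ Q y := by
    intro n
    induction n using Int.induction_on with
    | zero => simp
    | succ n ih =>
      intro y
      have := h2 (y + n * τ)
      rw [← ih y]; push_cast at *; rw [← this]; ring_nf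
    | pred n ih =>
      intro y
      have := h2 (y + (-n - 1) * τ)
      rw [← ih y]; push_cast at *; rw [← this]; ring_nf
  rw [a2, a1]

/-- product form of the theta function -/
def pr (τ u : ℂ) : ℂ :=
  eπ (-u) * poch1 (eπ (2 * u)) (eπ (2 * τ)) * poch1 (eπ (2 * τ - 2 * u)) (eπ (2 * τ))

lemma norm_p {τ : ℂ} (hτ : 0 < τ.im) : ‖eπ (2 * τ)‖ < 1 := norm_eπ_lt (by simpa using hτ)

lemma pr_diff {τ : ℂ} (hτ : 0 < τ.im) : Differentiable ℂ (pr τ) := by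
  have h := poch1_diff (norm_p hτ)
  unfold pr
  have h1 : Differentiable ℂ (fun u => poch1 (eπ (2 * u)) (eπ (2 * τ))) :=
    h.comp (g := fun x => poch1 x (eπ (2 * τ))) (by fun_prop)
  have h2 : Differentiable ℂ (fun u => poch1 (eπ (2 * τ - 2 * u)) (eπ (2 * τ))) :=
    h.comp (g := fun x => poch1 x (eπ (2 * τ))) (by fun_prop)
  fun_prop

lemma pr_add_one (τ u : ℂ) : pr τ (u + 1) = - pr τ u := by
  unfold pr
  have e1 : eπ (-(u + 1)) = - eπ (-u) := by
    rw [neg_add, eπ_add, eπ_neg 1, eπ_one]; norm_num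
  have e2 : eπ (2 * (u + 1)) = eπ (2 * u) := by rw [mul_add, eπ_add, mul_one, eπ_two, mul_one]
  have e3 : eπ (2 * τ - 2 * (u + 1)) = eπ (2 * τ - 2 * u) := by
    rw [eπ_sub, e2, ← eπ_sub]
  rw [e1, e2, e3]; ring

lemma pr_add_tau {τ : ℂ} (hτ : 0 < τ.im) (u : ℂ) :
    pr τ (u + τ) = - eπ (-τ - 2 * u) * pr τ u := by
  unfold pr
  have hp := norm_p hτ
  have e1 : eπ (2 * (u + τ)) = eπ (2 * u) * eπ (2 * τ) := by rw [mul_add, eπ_add]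
  have e2 : eπ (2 * τ - 2 * (u + τ)) = eπ (-(2 * u)) := by congr 1; ring
  have e3 : eπ (2 * τ - 2 * u) = eπ (-(2 * u)) * eπ (2 * τ) := by rw [← eπ_add]; congr 1; ring
  have e4 : eπ (-(u + τ)) = eπ (-τ - 2 * u) * eπ (2 * u) * eπ (-u) := by
    rw [← eπ_add, ← eπ_add]; congr 1; ring
  rw [e1, e2, e3, e4, poch1_succ hp (eπ (-(2 * u))), poch1_succ hp (eπ (2 * u))]
  have : eπ (2 * u) * eπ (-(2 * u)) = 1 := by rw [← eπ_add]; simp [eπ_zero]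
  linear_combination (-eπ (-τ - 2 * u) * eπ (-u) * poch1 (eπ (2 * u) * eπ (2 * τ)) (eπ (2 * τ))
    * poch1 (eπ (-(2 * u)) * eπ (2 * τ)) (eπ (2 * τ))) * this

lemma pr_eq_zero {τ : ℂ} (hτ : 0 < τ.im) {u : ℂ} (h : pr τ u = 0) :
    ∃ m n : ℤ, u = m + n * τ := by
  have hp := norm_p hτ
  unfold pr at h
  rcases mul_eq_zero.1 h with h | h
  · rcases mul_eq_zero.1 h with h | h
    · exact absurd h (eπ_ne _)
    · by_contra hc
      refine poch1_ne_zero hp (fun n hn => hc ?_) h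
      rw [← eπ_nat_mul, ← eπ_add] at hn
      obtain ⟨m, hm⟩ := eπ_two_mul_eq_one (a := u + n * τ) (by rw [← hn]; congr 1; ring)
      exact ⟨m, -n, by push_cast; linear_combination hm⟩
  · by_contra hc
    refine poch1_ne_zero hp (fun n hn => hc ?_) h
    rw [← eπ_nat_mul, ← eπ_add] at hn
    obtain ⟨m, hm⟩ := eπ_two_mul_eq_one (a := τ - u + n * τ) (by rw [← hn]; congr 1; ring)
    exact ⟨-m, n + 1, by push_cast; linear_combination -hm⟩

lemma pr_simple {τ : ℂ} (hτ : 0 < τ.im) {u : ℂ} (h : pr τ u = 0) : deriv (pr τ) u ≠ 0 := by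
  have hd := pr_diff hτ
  have hp := norm_p hτ
  obtain ⟨m, n, rfl⟩ := pr_eq_zero hτ h
  have key : (pr τ (0 + m + n * τ) = 0 ∧ deriv (pr τ) (0 + m + n * τ) ≠ 0) ↔
      (pr τ 0 = 0 ∧ deriv (pr τ) 0 ≠ 0) := by
    refine pred_shift (Q := fun u => pr τ u = 0 ∧ deriv (pr τ) u ≠ 0) ?_ ?_ m n 0
    · intro u
      have : deriv (pr τ) (u + 1) = - deriv (pr τ) u := by
        rw [← deriv_comp_add_const]
        simp_rw [pr_add_one]
        simp
      simp only [this, pr_add_one, neg_eq_zero, ne_eq]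
    · intro u
      have : deriv (pr τ) (u + τ) = deriv (fun v => - eπ (-τ - 2 * v)) u * pr τ u +
          (- eπ (-τ - 2 * u)) * deriv (pr τ) u := by
        rw [← deriv_comp_add_const]
        simp_rw [pr_add_tau hτ]
        exact deriv_fun_mul (by fun_prop) (hd u)
      have ne := eπ_ne (-τ - 2 * u)
      constructor
      · rintro ⟨h1, h2⟩
        rw [pr_add_tau hτ, mul_eq_zero] at h1
        have h1 := h1.resolve_left (neg_ne_zero.2 ne)
        refine ⟨h1, fun h3 => h2 ?_⟩
        rw [this, h1, h3]; simp
      · rintro ⟨h1, h2⟩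
        rw [this, pr_add_tau hτ, h1]
        simp [ne, h2]
  rw [zero_add] at key
  refine (key.2 ?_).2
  have e : pr τ = fun u => (1 - eπ (2 * u)) * (eπ (-u) * poch1 (eπ (2 * u) * eπ (2 * τ)) (eπ (2 * τ)) *
      poch1 (eπ (2 * τ - 2 * u)) (eπ (2 * τ))) := by
    ext u; rw [pr, poch1_succ hp (eπ (2 * u))]; ring
  have hne : poch1 (eπ (2 * τ)) (eπ (2 * τ)) ≠ 0 := by
    refine poch1_ne_zero hp (fun n hn => ?_)
    have := congrArg norm hn
    rw [← pow_succ', norm_pow, norm_one] at this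
    exact (pow_lt_one₀ (norm_nonneg _) hp (Nat.succ_ne_zero n)).ne this
  have h0 : pr τ 0 = 0 := by rw [e]; simp [eπ_zero]
  refine ⟨h0, ?_⟩
  have h := poch1_diff hp
  have d1 : Differentiable ℂ (fun u => poch1 (eπ (2 * u) * eπ (2 * τ)) (eπ (2 * τ))) :=
    h.comp (g := fun x => poch1 x (eπ (2 * τ))) (by fun_prop)
  have d2 : Differentiable ℂ (fun u => poch1 (eπ (2 * τ - 2 * u)) (eπ (2 * τ))) :=
    h.comp (g := fun x => poch1 x (eπ (2 * τ))) (by fun_prop)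
  have d3 : HasDerivAt (fun u => 1 - eπ (2 * u)) (-(Real.pi * I * 2)) 0 := by
    unfold eπ
    have : HasDerivAt (fun u : ℂ => Real.pi * I * (2 * u)) (Real.pi * I * 2) 0 := by
      simpa using ((hasDerivAt_id (0:ℂ)).const_mul 2).const_mul (Real.pi * I)
    simpa using this.cexp.const_sub 1
  rw [e, deriv_fun_mul d3.differentiableAt (by fun_prop), d3.deriv]
  simp [eπ_zero, hne]

/-- `th` is a multiple of the product -/
lemma th_eq_pr {τ : ℂ} (hτ : 0 < τ.im) : ∃ K : ℂ, ∀ u, th τ u = K * pr τ u := by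
  have lat : ∀ m n : ℤ, th τ (m + n * τ) = 0 := by
    intro m n
    have := pred_shift (τ := τ) (Q := fun u => th τ u = 0) (fun u => by simp [th_add_one])
      (fun u => by simp [th_add_tau, eπ_ne]) m n 0
    rw [zero_add] at this
    exact this.2 (th_zero τ)
  obtain ⟨Q, hQ, hQe⟩ := exists_div (th_diff hτ) (pr_diff hτ) (fun u => pr_simple hτ)
    (fun u hu => by obtain ⟨m, n, rfl⟩ := pr_eq_zero hτ hu; exact lat m n)
  have nz : pr τ (τ / 2) ≠ 0 := by
    intro h
    obtain ⟨m, n, h⟩ := pr_eq_zero hτ h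
    have := congrArg Complex.im h
    simp at this
    have h2 : ((2 * n : ℤ) : ℝ) = ((1 : ℤ) : ℝ) := by
      push_cast
      apply mul_right_cancel₀ hτ.ne'
      linear_combination -2 * this
    have := Int.cast_injective h2
    omega
  have q1 : ∀ u, Q (u + 1) = 1 * Q u := by
    intro u
    refine eq_of_eq_off_zeros (f := fun u => Q (u + 1)) (g := fun u => 1 * Q u) (pr_diff hτ) _ nz
      (by have := hQ.continuous; fun_prop) (by have := hQ.continuous; fun_prop) ?_
    refine Filter.Eventually.of_forall fun v hv => ?_
    have := hQe (v + 1)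
    rw [th_add_one, hQe, pr_add_one] at this
    apply mul_right_cancel₀ hv
    linear_combination this
  have q2 : ∀ u, Q (u + τ) = 1 * Q u := by
    intro u
    refine eq_of_eq_off_zeros (f := fun u => Q (u + τ)) (g := fun u => 1 * Q u) (pr_diff hτ) _ nz
      (by have := hQ.continuous; fun_prop) (by have := hQ.continuous; fun_prop) ?_
    refine Filter.Eventually.of_forall fun v hv => ?_
    have := hQe (v + τ)
    rw [th_add_tau, hQe, pr_add_tau hτ] at this
    apply mul_right_cancel₀ hv
    apply mul_left_cancel₀ (eπ_ne (-τ - 2 * v))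
    linear_combination this
  obtain ⟨K, c, hK⟩ := quasi_const hτ hQ one_ne_zero one_ne_zero q1 q2
  by_cases hK0 : K = 0
  · exact ⟨0, fun u => by rw [hQe, hK, hK0]; simp⟩
  have c1 : cexp c = 1 := by
    have := q1 0
    rw [hK, hK] at this; simpa [hK0] using this
  have c2 : cexp (c * τ) = 1 := by
    have := q2 0
    rw [hK, hK] at this; simpa [hK0] using this
  have c0 : c = 0 := by
    obtain ⟨n, hn⟩ := Complex.exp_eq_one_iff.1 c1
    obtain ⟨m, hm⟩ := Complex.exp_eq_one_iff.1 c2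
    have h2 : (2 * Real.pi * I : ℂ) ≠ 0 := by simp [Real.pi_ne_zero]
    have : (n : ℂ) * τ = m := by
      apply mul_right_cancel₀ h2
      rw [← hm, hn]; ring
    have := congrArg Complex.im this
    simp [hτ.ne'] at this
    rw [hn, this]; simp
  refine ⟨K, fun u => ?_⟩
  rw [hQe, hK, c0]; simp


lemma th_lat (τ : ℂ) (m n : ℤ) : th τ (m + n * τ) = 0 := by
  have := pred_shift (τ := τ) (Q := fun u => th τ u = 0) (fun u => by simp [th_add_one])
    (fun u => by simp [th_add_tau, eπ_ne]) m n 0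
  rw [zero_add] at this
  exact this.2 (th_zero τ)

lemma th_eq_zero {τ : ℂ} (hτ : 0 < τ.im) {w : ℂ} (hw : th τ w ≠ 0) {u : ℂ} (h : th τ u = 0) : ∃ m n : ℤ, u = m + n * τ := by
  obtain ⟨K, hK⟩ := th_eq_pr hτ
  have : K ≠ 0 := by rintro rfl; exact hw (by rw [hK]; simp)
  rw [hK, mul_eq_zero] at h
  exact pr_eq_zero hτ (h.resolve_left this)

lemma th_simple {τ : ℂ} (hτ : 0 < τ.im) {w : ℂ} (hw : th τ w ≠ 0) {u : ℂ} (h : th τ u = 0) : deriv (th τ) u ≠ 0 := by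
  obtain ⟨K, hK⟩ := th_eq_pr hτ
  have hK0 : K ≠ 0 := by rintro rfl; exact hw (by rw [hK]; simp)
  have e : th τ = fun u => K * pr τ u := funext hK
  rw [hK, mul_eq_zero] at h
  rw [e, deriv_const_mul _ (pr_diff hτ u)]
  exact mul_ne_zero hK0 (pr_simple hτ (h.resolve_left hK0))

lemma div_th {τ : ℂ} (hτ : 0 < τ.im) {w : ℂ} (hw : th τ w ≠ 0) {F : ℂ → ℂ}
    (hF : Differentiable ℂ F) {μ ν : ℂ} (hμ : μ ≠ 0) (hν : ν ≠ 0) (k : ℕ)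
    (h1 : ∀ y, F (y + 1) = μ * F y)
    (h2 : ∀ y, F (y + τ) = ν * eπ (-2 * (k + 1) * y) * F y) {s : ℂ} (hs : F s = 0) :
    ∃ Q : ℂ → ℂ, Differentiable ℂ Q ∧ (∀ y, F y = Q y * th τ (y - s)) ∧
      (∀ y, Q (y + 1) = (-μ) * Q y) ∧
      (∀ y, Q (y + τ) = (-ν * eπ (τ - 2 * s)) * eπ (-2 * k * y) * Q y) := by
  have hth := th_diff hτ
  have lat : ∀ m n : ℤ, F (s + m + n * τ) = 0 := by
    intro m n
    exact (pred_shift (τ := τ) (Q := fun u => F u = 0) (fun u => by simp [h1, hμ])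
      (fun u => by simp [h2, eπ_ne, hν]) m n s).2 hs
  have hG : Differentiable ℂ (fun y => th τ (y - s)) := by fun_prop
  obtain ⟨Q, hQ, hQe⟩ := exists_div hF hG
    (fun u hu => by
      rw [deriv_comp_sub_const (f := th τ)]
      exact th_simple hτ hw hu)
    (fun u hu => by
      obtain ⟨m, n, h⟩ := th_eq_zero hτ hw hu
      have := lat m n
      rwa [show s + m + n * τ = u by linear_combination -h] at this)
  have nz : th τ ((w + s) - s) ≠ 0 := by simpa using hw
  have hQc := hQ.continuous
  refine ⟨Q, hQ, hQe, fun u => ?_, fun u => ?_⟩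
  · refine eq_of_eq_off_zeros (f := fun u => Q (u + 1)) (g := fun u => -μ * Q u) hG _ nz
      (by fun_prop) (by fun_prop) (Filter.Eventually.of_forall fun v hv => ?_)
    have := hQe (v + 1)
    rw [h1, hQe, show v + 1 - s = v - s + 1 by ring, th_add_one] at this
    apply mul_right_cancel₀ hv
    linear_combination this
  · refine eq_of_eq_off_zeros (f := fun u => Q (u + τ))
      (g := fun u => (-ν * eπ (τ - 2 * s)) * eπ (-2 * k * u) * Q u) hG _ nz
      (by fun_prop) (by fun_prop) (Filter.Eventually.of_forall fun v hv => ?_)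
    have := hQe (v + τ)
    rw [h2, hQe, show v + τ - s = v - s + τ by ring, th_add_tau] at this
    apply mul_right_cancel₀ hv
    apply mul_left_cancel₀ (eπ_ne (-τ - 2 * (v - s)))
    have e : eπ (-τ - 2 * (v - s)) * eπ (τ - 2 * s) * eπ (-2 * k * v) = eπ (-2 * (k + 1) * v) := by
      rw [← eπ_add, ← eπ_add]; congr 1; ring
    linear_combination this + ν * Q v * th τ (v - s) * e

/-- degree two theta functions with three inequivalent zeros vanish -/
lemma deg_two_zero {τ : ℂ} (hτ : 0 < τ.im) {w : ℂ} (hw : th τ w ≠ 0) {F : ℂ → ℂ}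
    (hF : Differentiable ℂ F) {μ ν : ℂ} (hμ : μ ≠ 0) (hν : ν ≠ 0)
    (h1 : ∀ y, F (y + 1) = μ * F y)
    (h2 : ∀ y, F (y + τ) = ν * eπ (-4 * y) * F y) {a b c : ℂ} (ha : F a = 0) (hb : F b = 0)
    (hc : F c = 0) (hab : th τ (b - a) ≠ 0) (hac : th τ (c - a) ≠ 0) (hbc : th τ (c - b) ≠ 0)
    (y : ℂ) : F y = 0 := by
  obtain ⟨Q, hQ, hFQ, q1, q2⟩ := div_th hτ hw hF hμ hν 1 h1
    (fun y => by rw [h2]; congr 3; push_cast; ring) ha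
  have hQb : Q b = 0 := by
    have := hFQ b; rw [hb] at this; exact (mul_eq_zero.1 this.symm).resolve_right hab
  have hQc : Q c = 0 := by
    have := hFQ c; rw [hc] at this; exact (mul_eq_zero.1 this.symm).resolve_right hac
  obtain ⟨P, hP, hQP, p1, p2⟩ := div_th hτ hw hQ (neg_ne_zero.2 hμ)
    (mul_ne_zero (neg_ne_zero.2 hν) (eπ_ne _)) 0 q1
    (fun y => by rw [q2]; congr 3; push_cast; ring) hQb
  have hPc : P c = 0 := by
    have := hQP c; rw [hQc] at this; exact (mul_eq_zero.1 this.symm).resolve_right hbc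
  obtain ⟨K, d, hK⟩ := quasi_const hτ hP (neg_ne_zero.2 (neg_ne_zero.2 hμ))
    (mul_ne_zero (neg_ne_zero.2 (mul_ne_zero (neg_ne_zero.2 hν) (eπ_ne _))) (eπ_ne _)) p1
    (fun y => by rw [p2]; simp [eπ_zero]; left; rfl)
  have : K = 0 := by
    have := hK c; rw [hPc] at this
    exact (mul_eq_zero.1 this.symm).resolve_right (Complex.exp_ne_zero _)
  rw [hFQ, hQP, hK, this]; simp

/- finite sums over residues -/

lemma sum_fin_shift {M : Type*} [AddCommGroup M] {N : ℕ} {f : ℤ → M}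
    (hf : ∀ a, f (a + N) = f a) (k : ℤ) : ∑ i : Fin N, f ((i : ℕ) + k) = ∑ i : Fin N, f (i : ℕ) := by
  have one : ∀ g : ℤ → M, (∀ a, g (a + N) = g a) →
      ∑ i : Fin N, g ((i : ℕ) + 1) = ∑ i : Fin N, g (i : ℕ) := by
    intro g hg
    rw [Fin.sum_univ_eq_sum_range (fun i => g ((i : ℕ) + 1)),
      Fin.sum_univ_eq_sum_range (fun i => g (i : ℕ))]
    have h1 := Finset.sum_range_succ' (fun i : ℕ => g i) N
    rw [Finset.sum_range_succ] at h1
    have h2 := hg 0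
    rw [zero_add] at h2
    simp only [Nat.cast_zero, h2, add_left_inj] at h1
    rw [h1]; simp
  induction k using Int.induction_on with
  | zero => simp
  | succ n ih =>
    rw [← ih, ← one (fun a => f (a + n)) (fun a => by rw [← hf (a + n)]; ring_nf)]
    congr 1; ext i; congr 1; ring
  | pred n ih =>
    rw [← ih, ← one (fun a => f (a + (-n - 1))) (fun a => by rw [← hf (a + (-n - 1))]; ring_nf)]
    congr 1; ext i; congr 1; ring

lemma sum_fin_neg {M : Type*} [AddCommGroup M] {N : ℕ} {f : ℤ → M}
    (hf : ∀ a, f (a + N) = f a) : ∑ i : Fin N, f (-(i : ℕ)) = ∑ i : Fin N, f (i : ℕ) := by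
  rw [← sum_fin_shift hf 1, ← Equiv.sum_comp Fin.revPerm (fun i : Fin N => f (-(i : ℕ)))]
  congr 1; ext i
  rw [← hf (-_)]
  congr 1
  simp only [Fin.revPerm_apply, Fin.val_rev]
  have := i.2
  omega

/-- doubly periodic functions -/
def Per {M : Type*} (N : ℕ) (f : ℤ × ℤ → M) : Prop :=
  ∀ a b, f (a + N, b) = f (a, b) ∧ f (a, b + N) = f (a, b)

/-- sum over residues -/
def sumN {M : Type*} [AddCommMonoid M] (N : ℕ) (f : ℤ × ℤ → M) : M :=
  ∑ α : Fin N × Fin N, f (((α.1 : ℕ) : ℤ), ((α.2 : ℕ) : ℤ))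

lemma sumN_shift {M : Type*} [AddCommGroup M] {N : ℕ} {f : ℤ × ℤ → M} (hf : Per N f) (γ : ℤ × ℤ) :
    sumN N (fun α => f (α + γ)) = sumN N f := by
  obtain ⟨c, d⟩ := γ
  unfold sumN
  rw [Fintype.sum_prod_type, Fintype.sum_prod_type]
  simp only [Prod.mk_add_mk]
  rw [sum_fin_shift (f := fun a => ∑ j : Fin N, f (a, (j : ℕ) + d)) (fun a => by simp [(hf _ _).1])]
  congr 1; ext i
  exact sum_fin_shift (f := fun b => f ((i : ℕ), b)) (fun a => (hf _ _).2) d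

lemma sumN_neg {M : Type*} [AddCommGroup M] {N : ℕ} {f : ℤ × ℤ → M} (hf : Per N f) :
    sumN N (fun α => f (-α)) = sumN N f := by
  unfold sumN
  rw [Fintype.sum_prod_type, Fintype.sum_prod_type]
  simp only [Prod.neg_mk]
  rw [sum_fin_neg (f := fun a => ∑ j : Fin N, f (a, -(j : ℕ))) (fun a => by simp [(hf _ _).1])]
  congr 1; ext i
  exact sum_fin_neg (f := fun b => f ((i : ℕ), b)) (fun a => (hf _ _).2)

lemma sumN_congr {M : Type*} [AddCommMonoid M] {N : ℕ} {f g : ℤ × ℤ → M} (h : ∀ α, f α = g α) :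
    sumN N f = sumN N g := by rw [funext h]

lemma sumN_mul_left {N : ℕ} (c : ℂ) (f : ℤ × ℤ → ℂ) :
    sumN N (fun α => c * f α) = c * sumN N f := by
  unfold sumN; rw [Finset.mul_sum]

lemma sumN_comm {M : Type*} [AddCommMonoid M] {N : ℕ} (f : ℤ × ℤ → ℤ × ℤ → M) :
    sumN N (fun α => sumN N (fun β => f α β)) = sumN N (fun β => sumN N (fun α => f α β)) := by
  unfold sumN; exact Finset.sum_comm

/-- roots of unity -/
def om (N : ℕ) (k : ℤ) : ℂ := eπ (2 * k / N)
/-- symplectic pairing -/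
def pg (α β : ℤ × ℤ) : ℤ := α.1 * β.2 - α.2 * β.1

lemma om_add (N : ℕ) (a b : ℤ) : om N (a + b) = om N a * om N b := by
  rw [om, om, om, ← eπ_add]; congr 1; push_cast; ring
lemma om_zero (N : ℕ) : om N 0 = 1 := by simp [om, eπ_zero]
lemma om_neg_mul (N : ℕ) (a : ℤ) : om N (-a) * om N a = 1 := by
  rw [← om_add]; simp [om_zero]
lemma om_ne (N : ℕ) (a : ℤ) : om N a ≠ 0 := eπ_ne _
lemma om_mul_N {N : ℕ} (hN : 0 < N) (a : ℤ) : om N (N * a) = 1 := by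
  rw [om, ← eπ_two_int a]; congr 1
  have : (N : ℂ) ≠ 0 := by exact_mod_cast hN.ne'
  push_cast; field_simp
lemma om_eq_one {N : ℕ} (hN : 0 < N) {a : ℤ} (h : om N a = 1) : (N : ℤ) ∣ a := by
  rw [om, mul_div_assoc] at h
  obtain ⟨n, hn⟩ := eπ_two_mul_eq_one h
  have : (N : ℂ) ≠ 0 := by exact_mod_cast hN.ne'
  refine ⟨n, ?_⟩
  field_simp at hn
  exact_mod_cast hn
lemma om_congr {N : ℕ} (hN : 0 < N) {a b : ℤ} (h : (N : ℤ) ∣ a - b) : om N a = om N b := by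
  obtain ⟨c, hc⟩ := h
  rw [show a = N * c + b by omega, om_add, om_mul_N hN, one_mul]

lemma pg_add_left (α β γ : ℤ × ℤ) : pg (α + β) γ = pg α γ + pg β γ := by
  simp only [pg, Prod.fst_add, Prod.snd_add]; ring

lemma per_om {N : ℕ} (hN : 0 < N) (γ : ℤ × ℤ) : Per N (fun α => om N (pg α γ)) := by
  intro a b
  constructor
  · exact om_congr hN ⟨γ.2, by simp only [pg]; ring⟩
  · exact om_congr hN ⟨-γ.1, by simp only [pg]; ring⟩

lemma Per.mul {N : ℕ} {f g : ℤ × ℤ → ℂ} (hf : Per N f) (hg : Per N g) :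
    Per N (fun α => f α * g α) := fun a b =>
  ⟨by simp only [(hf a b).1, (hg a b).1], by simp only [(hf a b).2, (hg a b).2]⟩

lemma Per.shift {M : Type*} {N : ℕ} {f : ℤ × ℤ → M} (hf : Per N f) (γ : ℤ × ℤ) :
    Per N (fun α => f (α + γ)) := by
  obtain ⟨c, d⟩ := γ
  intro a b
  simp only [Prod.mk_add_mk]
  rw [add_right_comm a, add_right_comm b, (hf _ _).1, (hf _ _).2]; simp

lemma Per.neg {M : Type*} {N : ℕ} {f : ℤ × ℤ → M} (hf : Per N f) :
    Per N (fun α => f (-α)) := by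
  intro a b
  simp only [Prod.neg_mk]
  constructor
  · rw [← (hf _ _).1]; congr 2; ring
  · rw [← (hf _ _).2]; congr 2; ring

lemma char_sum {N : ℕ} (hN : 0 < N) {γ : ℤ × ℤ} (h : ¬ ((N : ℤ) ∣ γ.1 ∧ (N : ℤ) ∣ γ.2)) :
    sumN N (fun α => om N (pg α γ)) = 0 := by
  have key : ∀ δ : ℤ × ℤ, om N (pg δ γ) ≠ 1 → sumN N (fun α => om N (pg α γ)) = 0 := by
    intro δ hδ
    have := sumN_shift (per_om hN γ) δ
    simp only [pg_add_left, om_add] at this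
    rw [sumN_congr (g := fun α => om N (pg δ γ) * om N (pg α γ)) (fun α => mul_comm _ _),
      sumN_mul_left] at this
    have : (om N (pg δ γ) - 1) * sumN N (fun α => om N (pg α γ)) = 0 := by
      linear_combination this
    exact (mul_eq_zero.1 this).resolve_left (sub_ne_zero.2 hδ)
  rcases not_and_or.1 h with h | h
  · exact key (0, -1) (fun h' => h (by have := om_eq_one hN h'; simpa [pg] using this))
  · exact key (1, 0) (fun h' => h (by have := om_eq_one hN h'; simpa [pg] using this))

lemma char_sum_zero {N : ℕ} : sumN N (fun α => om N (pg α 0)) = (N : ℂ) ^ 2 := by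
  simp [pg, om_zero, sumN]; ring

lemma fin_pair_zero {N : ℕ} {a : Fin N × Fin N}
    (h : (N : ℤ) ∣ ((a.1 : ℕ) : ℤ) ∧ (N : ℤ) ∣ ((a.2 : ℕ) : ℤ)) : (a.1 : ℕ) = 0 ∧ (a.2 : ℕ) = 0 := by
  rw [Int.natCast_dvd_natCast, Int.natCast_dvd_natCast] at h
  exact ⟨Nat.eq_zero_of_dvd_of_lt h.1 a.1.2, Nat.eq_zero_of_dvd_of_lt h.2 a.2.2⟩

/-- lattice fraction -/
def aa (N : ℕ) (τ : ℂ) (γ : ℤ × ℤ) : ℂ := (γ.1 * τ + γ.2) / N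

/-- theta quotient -/
def ww (N : ℕ) (τ : ℂ) (α : ℤ × ℤ) (ξ x : ℂ) : ℂ :=
  eπ (2 * α.1 * ξ / N) * (th τ (x + ξ + aa N τ α) / th τ (x + aa N τ α))

lemma aa_add (N : ℕ) (τ : ℂ) (α β : ℤ × ℤ) : aa N τ (α + β) = aa N τ α + aa N τ β := by
  simp only [aa, Prod.fst_add, Prod.snd_add]; push_cast; ring
lemma aa_neg (N : ℕ) (τ : ℂ) (α : ℤ × ℤ) : aa N τ (-α) = - aa N τ α := by
  simp only [aa, Prod.fst_neg, Prod.snd_neg]; push_cast; ring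

lemma castN {N : ℕ} (hN : 0 < N) : (N : ℂ) ≠ 0 := by exact_mod_cast hN.ne'

lemma lat_inj {τ : ℂ} (hτ : 0 < τ.im) {a b c d : ℤ} (h : (a : ℂ) * τ + b = c * τ + d) :
    a = c ∧ b = d := by
  have h1 := congrArg Complex.im h
  simp at h1
  have h2 : a = c := by
    rcases h1 with h1 | h1
    · exact_mod_cast h1
    · exact absurd h1 hτ.ne'
  subst h2
  refine ⟨rfl, ?_⟩
  have := add_left_cancel h
  exact_mod_cast this

lemma th_aa {N : ℕ} (hN : 0 < N) {τ : ℂ} (hτ : 0 < τ.im) {w : ℂ} (hw : th τ w ≠ 0) {γ : ℤ × ℤ}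
    (h : th τ (aa N τ γ) = 0) : (N : ℤ) ∣ γ.1 ∧ (N : ℤ) ∣ γ.2 := by
  obtain ⟨m, n, h⟩ := th_eq_zero hτ hw h
  have hn := castN hN
  rw [aa, div_eq_iff hn] at h
  have := lat_inj hτ (a := γ.1) (b := γ.2) (c := N * n) (d := N * m)
    (by rw [h]; push_cast; ring)
  exact ⟨⟨n, this.1⟩, ⟨m, this.2⟩⟩

lemma th_div_ne {N : ℕ} (hN : 0 < N) {τ : ℂ} (hτ : 0 < τ.im) {y : ℂ} (hy : th τ y ≠ 0)
    (γ : ℤ × ℤ) : th τ (y / N + aa N τ γ) ≠ 0 := by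
  intro h
  obtain ⟨m, n, h⟩ := th_eq_zero hτ hy h
  have hn := castN hN
  apply hy
  have : y = ((N * m - γ.2 : ℤ) : ℂ) + ((N * n - γ.1 : ℤ) : ℂ) * τ := by
    rw [aa] at h; field_simp at h; push_cast; linear_combination h
  rw [this]; exact th_lat _ _ _

lemma th_ne_of_div {N : ℕ} (hN : 0 < N) {τ : ℂ} (hτ : 0 < τ.im) {w : ℂ} (hw : th τ w ≠ 0) {y : ℂ}
    (hy : ∀ α : Fin N × Fin N, th τ (y / N + aa N τ (((α.1 : ℕ) : ℤ), ((α.2 : ℕ) : ℤ))) ≠ 0) :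
    th τ y ≠ 0 := by
  intro h
  obtain ⟨m, n, h⟩ := th_eq_zero hτ hw h
  have hn := castN hN
  have hN' : (N : ℤ) ≠ 0 := by exact_mod_cast hN.ne'
  have red : ∀ k : ℤ, ∃ (i : Fin N) (c : ℤ), k + (i : ℕ) = N * c := by
    intro k
    have h0 := Int.emod_nonneg (-k) hN'
    have h1 := Int.emod_lt_of_pos (-k) (b := N) (by exact_mod_cast hN)
    have h2 := Int.emod_add_mul_ediv (-k) N
    refine ⟨⟨((-k) % N).toNat, by omega⟩, -((-k) / N), ?_⟩
    simp only [Int.toNat_of_nonneg h0]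
    linarith
  obtain ⟨i, c, hc⟩ := red n
  obtain ⟨j, d, hd⟩ := red m
  apply hy (i, j)
  have hc' : (n : ℂ) + (i : ℕ) = N * c := by exact_mod_cast congrArg (Int.cast (R := ℂ)) hc
  have hd' : (m : ℂ) + (j : ℕ) = N * d := by exact_mod_cast congrArg (Int.cast (R := ℂ)) hd
  have : y / N + aa N τ (((i : ℕ) : ℤ), ((j : ℕ) : ℤ)) = d + c * τ := by
    rw [aa, h]; field_simp; push_cast; linear_combination hc' * τ + hd'
  simp only
  rw [this]; exact th_lat _ _ _

lemma ww_per {N : ℕ} (hN : 0 < N) (τ ξ x : ℂ) : Per N (fun α => ww N τ α ξ x) := by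
  have hn := castN hN
  intro a b
  constructor
  · have e : aa N τ (a + N, b) = aa N τ (a, b) + τ := by
      simp only [aa]; push_cast; field_simp; ring
    simp only [ww, e, ← add_assoc, th_add_tau]
    rw [mul_div_mul_comm, ← mul_assoc]
    congr 1
    rw [neg_div_neg_eq, ← eπ_sub, ← eπ_add]
    congr 1; push_cast; field_simp; ring
  · have e : aa N τ (a, b + N) = aa N τ (a, b) + 1 := by
      simp only [aa]; push_cast; field_simp; ring
    simp only [ww, e, ← add_assoc, th_add_one]
    rw [neg_div_neg_eq]

lemma ww_x_one {N : ℕ} (τ ξ y : ℂ) (α : ℤ × ℤ) :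
    ww N τ α ξ ((y + 1) / N) = ww N τ (α + (0, 1)) ξ (y / N) := by
  simp only [ww, aa_add, Prod.fst_add, add_zero]
  have : aa N τ (0, 1) = 1 / N := by simp [aa]
  rw [this]
  congr 3 <;> ring_nf

lemma ww_x_tau {N : ℕ} (τ ξ y : ℂ) (α : ℤ × ℤ) :
    ww N τ α ξ ((y + τ) / N) = eπ (-2 * ξ / N) * ww N τ (α + (1, 0)) ξ (y / N) := by
  simp only [ww, aa_add, Prod.fst_add]
  have : aa N τ (1, 0) = τ / N := by simp [aa]
  rw [this, ← mul_assoc, ← eπ_add]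
  congr 1
  · congr 1; push_cast; ring
  · congr 2 <;> ring

lemma ww_neg {N : ℕ} (τ ξ x : ℂ) (α : ℤ × ℤ) : ww N τ (-α) ξ (-x) = ww N τ α (-ξ) x := by
  simp only [ww, aa_neg, Prod.fst_neg]
  rw [show -x + ξ + -aa N τ α = -(x + -ξ + aa N τ α) by ring,
    show -x + -aa N τ α = -(x + aa N τ α) by ring, th_neg, th_neg, neg_div_neg_eq]
  congr 2; push_cast; ring

lemma ww_inv {N : ℕ} (τ ξ x : ℂ) (α : ℤ × ℤ) (h1 : th τ (x + ξ + aa N τ α) ≠ 0)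
    (h2 : th τ (x + aa N τ α) ≠ 0) : ww N τ α (-ξ) (x + ξ) * ww N τ α ξ x = 1 := by
  simp only [ww]
  rw [show x + ξ + -ξ = x by ring]
  have : eπ (2 * α.1 * -ξ / N) * eπ (2 * α.1 * ξ / N) = 1 := by
    rw [← eπ_add, ← eπ_zero]; congr 1; ring
  generalize eπ (2 * α.1 * -ξ / N) = u1 at *
  generalize eπ (2 * α.1 * ξ / N) = u2 at *
  field_simp
  linear_combination this

lemma ww_xi_one {N : ℕ} (τ ξ x : ℂ) (α : ℤ × ℤ) :
    ww N τ α (ξ + 1) x = - om N α.1 * ww N τ α ξ x := by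
  simp only [ww, om]
  rw [show x + (ξ + 1) + aa N τ α = x + ξ + aa N τ α + 1 by ring, th_add_one,
    show 2 * (α.1 : ℂ) * (ξ + 1) / N = 2 * α.1 * ξ / N + 2 * α.1 / N by ring, eπ_add]
  ring

lemma ww_xi_tau {N : ℕ} (τ ξ x : ℂ) (α : ℤ × ℤ) :
    ww N τ α (ξ + τ) x = - eπ (-τ - 2 * x - 2 * ξ) * om N (-α.2) * ww N τ α ξ x := by
  simp only [ww, om]
  rw [show x + (ξ + τ) + aa N τ α = x + ξ + aa N τ α + τ by ring, th_add_tau]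
  have : eπ (2 * α.1 * (ξ + τ) / N) * eπ (-τ - 2 * (x + ξ + aa N τ α)) =
    eπ (-τ - 2 * x - 2 * ξ) * eπ (2 * (-α.2 : ℤ) / N) * eπ (2 * α.1 * ξ / N) := by
    rw [← eπ_add, ← eπ_add, ← eπ_add]; congr 1; simp only [aa]; push_cast; ring
  linear_combination (-th τ (x + ξ + aa N τ α) / th τ (x + aa N τ α)) * this

lemma ww_zero {N : ℕ} (τ x : ℂ) (α : ℤ × ℤ) (h : th τ (x + aa N τ α) ≠ 0) :
    ww N τ α 0 x = 1 := by
  simp [ww, eπ_zero, h]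

lemma ww_diff {N : ℕ} {τ : ℂ} (hτ : 0 < τ.im) (x : ℂ) (α : ℤ × ℤ) :
    Differentiable ℂ (fun ξ => ww N τ α ξ x) := by
  have := th_diff hτ
  simp only [ww, div_eq_mul_inv]
  fun_prop

lemma sumN_diff {N : ℕ} {f : ℤ × ℤ → ℂ → ℂ} (h : ∀ α, Differentiable ℂ (f α)) :
    Differentiable ℂ (fun y => sumN N (fun α => f α y)) := by
  unfold sumN
  exact Differentiable.fun_sum (fun i _ => h _)

lemma sumN_single {N : ℕ} (hN : 0 < N) (f : ℤ × ℤ → ℂ)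
    (h : ∀ α : ℤ × ℤ, ¬ ((N : ℤ) ∣ α.1 ∧ (N : ℤ) ∣ α.2) → f α = 0) : sumN N f = f 0 := by
  unfold sumN
  rw [Finset.sum_eq_single ((⟨0, hN⟩, ⟨0, hN⟩) : Fin N × Fin N)]
  · simp; rfl
  · intro b _ hb
    apply h
    intro h'
    have := fin_pair_zero h'
    exact hb (Prod.ext (Fin.ext this.1) (Fin.ext this.2))
  · simp

lemma I1 {N : ℕ} (hN : 0 < N) {τ : ℂ} (hτ : 0 < τ.im) (γ : ℤ × ℤ) (ξ y : ℂ) (hy : th τ y ≠ 0)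
    (hx : th τ (ξ / N + aa N τ γ) ≠ 0) :
    th τ y * sumN N (fun α => om N (pg α γ) * ww N τ α ξ (y / N)) =
      N * th τ ξ * ww N τ γ y (ξ / N) := by
  have hn := castN hN
  have hth := th_diff hτ
  have hthc := hth.continuous
  have exQ : ∀ α : ℤ × ℤ, ∃ Q : ℂ → ℂ, Differentiable ℂ Q ∧
      ∀ u, th τ u = Q u * th τ (u / N + aa N τ α) := by
    intro α
    refine exists_div hth (by fun_prop) (fun u hu => ?_) (fun u hu => ?_)
    · have hd : HasDerivAt (fun u : ℂ => th τ (u / N + aa N τ α))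
          (deriv (th τ) (u / N + aa N τ α) * (1 / N)) u :=
        (hth _).hasDerivAt.comp u (((hasDerivAt_id u).div_const (N : ℂ)).add_const _)
      rw [hd.deriv]
      exact mul_ne_zero (th_simple hτ hy hu) (by simp [hN.ne'])
    · by_contra h; exact th_div_ne hN hτ h α hu
  choose Q hQ hQe using exQ
  set Ψ : ℂ → ℂ := fun y => sumN N (fun α => om N (pg α γ) * ww N τ α ξ (y / N)) with hΨ
  set H : ℂ → ℂ := fun y => sumN N (fun α => om N (pg α γ) * eπ (2 * α.1 * ξ / N) *
    th τ (y / N + ξ + aa N τ α) * Q α y) with hH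
  have hHd : Differentiable ℂ H := sumN_diff (fun α => by have := hQ α; fun_prop)
  have hHc := hHd.continuous
  have HΨ : ∀ y, th τ y ≠ 0 → H y = th τ y * Ψ y := by
    intro y hy
    simp only [hH, hΨ]
    rw [← sumN_mul_left]
    apply sumN_congr
    intro α
    have h1 := th_div_ne hN hτ hy α
    have h2 := hQe α y
    rw [h2, ww]
    generalize th τ (y / N + aa N τ α) = u1 at *
    generalize th τ (y / N + ξ + aa N τ α) = u2 at *
    generalize eπ (2 * α.1 * ξ / N) = u3 at *
    field_simp
  have P1 : ∀ y, Ψ (y + 1) = om N γ.1 * Ψ y := by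
    intro y
    simp only [hΨ]
    rw [← sumN_shift (((per_om hN γ).mul (ww_per hN τ ξ (y / N)))) (0, 1), ← sumN_mul_left]
    apply sumN_congr; intro α
    rw [ww_x_one, ← mul_assoc, ← om_add]
    congr 2; simp [pg]; ring
  have P2 : ∀ y, Ψ (y + τ) = eπ (-2 * ξ / N) * om N (-γ.2) * Ψ y := by
    intro y
    simp only [hΨ]
    rw [← sumN_shift (((per_om hN γ).mul (ww_per hN τ ξ (y / N)))) (1, 0), ← sumN_mul_left]
    apply sumN_congr; intro α
    have : om N (pg α γ) = om N (-γ.2) * om N (pg (α + (1, 0)) γ) := by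
      rw [← om_add]; congr 1; simp [pg]; ring
    rw [ww_x_tau, this]; ring
  have H1 : ∀ y, H (y + 1) = (-om N γ.1) * H y := by
    intro v
    refine eq_of_eq_off_zeros (f := fun u => H (u + 1)) (g := fun u => (-om N γ.1) * H u) hth _ hy
      (by fun_prop) (by fun_prop) (Filter.Eventually.of_forall fun v hv => ?_)
    rw [HΨ v hv, HΨ (v + 1) (by simpa [th_add_one] using hv), th_add_one, P1]; ring
  set ν : ℂ := -(eπ (-τ - 2 * ξ / N) * om N (-γ.2)) with hν
  have H2 : ∀ y, H (y + τ) = ν * eπ (-2 * y) * H y := by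
    intro v
    refine eq_of_eq_off_zeros (f := fun u => H (u + τ))
      (g := fun u => ν * eπ (-2 * u) * H u) hth _ hy
      (by fun_prop) (by fun_prop) (Filter.Eventually.of_forall fun v hv => ?_)
    rw [HΨ v hv, HΨ (v + τ) (by simpa [th_add_tau, eπ_ne] using hv), th_add_tau, P2, hν]
    have : eπ (-τ - 2 * v) * eπ (-2 * ξ / N) = eπ (-τ - 2 * ξ / N) * eπ (-2 * v) := by
      rw [← eπ_add, ← eπ_add]; congr 1; ring
    linear_combination (-th τ v * om N (-γ.2) * Ψ v) * this
  have H0 : H 0 = N * th τ ξ := by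
    simp only [hH]
    rw [sumN_single hN]
    · have hd : HasDerivAt (fun u : ℂ => Q 0 u * th τ (u / N + aa N τ 0))
          (deriv (Q 0) 0 * th τ (0 / N + aa N τ 0) +
            Q 0 0 * (deriv (th τ) (0 / N + aa N τ 0) * (1 / N))) 0 :=
        (hQ 0 0).hasDerivAt.mul ((hth _).hasDerivAt.comp (0 : ℂ)
          (((hasDerivAt_id (0 : ℂ)).div_const (N : ℂ)).add_const _))
      have e : (fun u : ℂ => Q 0 u * th τ (u / N + aa N τ 0)) = th τ :=
        funext fun u => (hQe 0 u).symm
      have a0 : aa N τ 0 = 0 := by simp [aa]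
      have hd' := hd.deriv
      rw [e, a0, zero_div, add_zero, th_zero] at hd'
      have ds := th_simple hτ hy (th_zero τ)
      have q0 : Q 0 0 = N := by
        field_simp at hd'
        have : deriv (th τ) 0 * (N - Q 0 0) = 0 := by linear_combination hd'
        have := (mul_eq_zero.1 this).resolve_left ds
        linear_combination -this
      rw [q0, a0]; simp [pg, om_zero, eπ_zero]; ring
    · intro α hα
      have : th τ (aa N τ α) ≠ 0 := fun h => hα (th_aa hN hτ hy h)
      have h := hQe α 0
      rw [th_zero, zero_div, zero_add] at h
      rw [(mul_eq_zero.1 h.symm).resolve_right this]; simp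
  set T : ℂ → ℂ := fun y => eπ (2 * γ.1 * y / N) * th τ (y + ξ / N + aa N τ γ) with hT
  have T1 : ∀ y, T (y + 1) = (-om N γ.1) * T y := by
    intro y
    simp only [hT]
    rw [show y + 1 + ξ / N + aa N τ γ = y + ξ / N + aa N τ γ + 1 by ring, th_add_one,
      show 2 * (γ.1 : ℂ) * (y + 1) / N = 2 * γ.1 * y / N + 2 * γ.1 / N by ring, eπ_add, om]
    ring
  have T2 : ∀ y, T (y + τ) = ν * eπ (-2 * y) * T y := by
    intro y
    simp only [hT]
    rw [show y + τ + ξ / N + aa N τ γ = y + ξ / N + aa N τ γ + τ by ring, th_add_tau, hν, om]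
    have : eπ (2 * γ.1 * (y + τ) / N) * eπ (-τ - 2 * (y + ξ / N + aa N τ γ)) =
      eπ (-τ - 2 * ξ / N) * eπ (2 * (-γ.2 : ℤ) / N) * eπ (-2 * y) * eπ (2 * γ.1 * y / N) := by
      rw [← eπ_add, ← eπ_add, ← eπ_add, ← eπ_add]; congr 1; simp only [aa]; push_cast; ring
    linear_combination (-th τ (y + ξ / N + aa N τ γ)) * this
  set t := th τ (ξ / N + aa N τ γ) with ht
  set D : ℂ → ℂ := fun y => H y * t - N * th τ ξ * T y with hD
  have hTd : Differentiable ℂ T := by simp only [hT]; fun_prop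
  have hDd : Differentiable ℂ D := by simp only [hD]; fun_prop
  have ν0 : ν ≠ 0 := neg_ne_zero.2 (mul_ne_zero (eπ_ne _) (om_ne _ _))
  obtain ⟨q, hq, hqe, q1, q2⟩ := div_th hτ hy hDd (neg_ne_zero.2 (om_ne N γ.1)) ν0 0
    (fun y => by simp only [hD, H1, T1]; ring)
    (fun y => by simp only [hD, H2, T2]; simp; ring) (s := 0)
    (by simp only [hD, H0, hT]; rw [ht]; simp [eπ_zero])
  have q2' : ∀ y, q (y + τ) = (eπ (-2 * ξ / N) * om N (-γ.2)) * q y := by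
    intro y
    rw [q2, hν]
    have : eπ (-τ - 2 * ξ / N) * eπ (τ - 2 * 0) * eπ (-2 * (0 : ℕ) * y) = eπ (-2 * ξ / N) := by
      rw [← eπ_add, ← eπ_add]; congr 1; push_cast; ring
    linear_combination om N (-γ.2) * q y * this
  obtain ⟨K, c, hK⟩ := quasi_const hτ hq (neg_ne_zero.2 (neg_ne_zero.2 (om_ne N γ.1)))
    (mul_ne_zero (eπ_ne _) (om_ne _ _)) q1 q2'
  have K0 : K = 0 := by
    by_contra hK0
    obtain ⟨c', rfl⟩ : ∃ c', c = Real.pi * I * c' := by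
      have : (Real.pi : ℂ) * I ≠ 0 := by simp [Real.pi_ne_zero]
      exact ⟨c / (Real.pi * I), by field_simp⟩
    have hK' : ∀ y, q y = K * eπ (c' * y) := by
      intro y; rw [hK, eπ]; ring_nf
    have a1 := q1 0
    have a2 := q2' 0
    simp only [hK', mul_zero, eπ_zero, zero_add, mul_one, neg_neg] at a1 a2
    have b1 : eπ (2 * (c' / 2 - γ.1 / N)) = 1 := by
      have : eπ c' = om N γ.1 := by
        apply mul_left_cancel₀ hK0; linear_combination a1
      rw [show 2 * (c' / 2 - (γ.1 : ℂ) / N) = c' - 2 * γ.1 / N by ring, eπ_sub, this, om,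
        div_self (eπ_ne _)]
    have b2 : eπ (2 * (c' * τ / 2 + ξ / N + γ.2 / N)) = 1 := by
      have : eπ (c' * τ) = eπ (-2 * ξ / N) * om N (-γ.2) := by
        apply mul_left_cancel₀ hK0; linear_combination a2
      rw [show 2 * (c' * τ / 2 + ξ / N + γ.2 / N) = c' * τ + (2 * ξ / N + 2 * γ.2 / N) by ring,
        eπ_add, this, om, ← eπ_add, ← eπ_add, ← eπ_zero]
      congr 1; push_cast; ring
    obtain ⟨m, hm⟩ := eπ_two_mul_eq_one b1
    obtain ⟨n, hn'⟩ := eπ_two_mul_eq_one b2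
    apply hx
    have : ξ / N + aa N τ γ = (n : ℂ) + ((-m : ℤ) : ℂ) * τ := by
      rw [aa]; push_cast; linear_combination hn' - τ * hm
    rw [ht, this]; exact th_lat _ _ _
  have := hqe y
  rw [hK, K0, zero_mul, zero_mul] at this
  simp only [hD] at this
  rw [HΨ y hy] at this
  rw [ww, ← ht, show ξ / N + y + aa N τ γ = y + ξ / N + aa N τ γ by ring]
  simp only [hT] at this
  generalize th τ (y + ξ / N + aa N τ γ) = u2 at *
  generalize eπ (2 * γ.1 * y / N) = u3 at *
  rw [← mul_div_assoc, ← mul_div_assoc, eq_div_iff hx]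
  linear_combination this

/-- character sum -/
def cs (N : ℕ) (γ : ℤ × ℤ) : ℂ := sumN N (fun α => om N (pg α γ))

lemma cs_zero (N : ℕ) : cs N 0 = (N : ℂ) ^ 2 := char_sum_zero

lemma cs_per {N : ℕ} (hN : 0 < N) : Per N (cs N) := by
  intro a b
  constructor
  · exact sumN_congr (fun α => om_congr hN ⟨-α.2, by simp only [pg]; ring⟩)
  · exact sumN_congr (fun α => om_congr hN ⟨α.1, by simp only [pg]; ring⟩)

lemma ndvd_neg {N : ℕ} {γ : ℤ × ℤ} (h : ¬ ((N : ℤ) ∣ γ.1 ∧ (N : ℤ) ∣ γ.2)) :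
    ¬ ((N : ℤ) ∣ (-γ).1 ∧ (N : ℤ) ∣ (-γ).2) := by
  simpa using h

lemma cross_aux {N : ℕ} (hN : 0 < N) {τ : ℂ} (hτ : 0 < τ.im) {ζ : ℂ} (hζ : th τ ζ ≠ 0)
    (γ : ℤ × ℤ) (ξ : ℂ) (h1 : th τ ξ ≠ 0) (h2 : th τ (ξ + N * ζ) ≠ 0) :
    th τ ζ ^ 2 * sumN N (fun α => ww N τ α ξ (ζ / N) * ww N τ (α - γ) (-(ξ + N * ζ)) (ζ / N)) =
      cs N (-γ) * th τ ξ * th τ (-(ξ + N * ζ)) := by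
  have hn := castN hN
  set ξ' := -(ξ + N * ζ) with hξ'
  have h3 : th τ ξ' ≠ 0 := by rw [hξ', th_neg]; simpa using h2
  have key : N * (th τ ζ ^ 2 * sumN N (fun α => ww N τ α ξ (ζ / N) * ww N τ (α - γ) ξ' (ζ / N))) =
      th τ ζ * th τ ξ' * sumN N (fun α => sumN N (fun ε =>
        ww N τ α ξ (ζ / N) * (om N (pg ε (α - γ)) * ww N τ ε ζ (ξ' / N)))) := by
    rw [← sumN_mul_left, ← sumN_mul_left, ← sumN_mul_left]
    apply sumN_congr; intro α
    have := I1 hN hτ (α - γ) ζ ξ' h3 (th_div_ne hN hτ hζ _)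
    rw [sumN_mul_left]
    linear_combination -ww N τ α ξ (ζ / N) * th τ ζ * this
  have key2 : th τ ζ * sumN N (fun α => sumN N (fun ε =>
        ww N τ α ξ (ζ / N) * (om N (pg ε (α - γ)) * ww N τ ε ζ (ξ' / N)))) =
      N * th τ ξ * cs N (-γ) := by
    rw [sumN_comm, cs, ← sumN_mul_left, ← sumN_mul_left]
    apply sumN_congr; intro ε
    have i1 := I1 hN hτ (-ε) ξ ζ hζ (th_div_ne hN hτ h1 _)
    have i2 := ww_inv (N := N) τ ζ (ξ / N) (-ε)
      (by have := th_div_ne hN hτ h2 (-ε)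
          rwa [show (ξ + N * ζ) / N = ξ / N + ζ by field_simp] at this)
      (th_div_ne hN hτ h1 _)
    have i3 : ww N τ ε ζ (ξ' / N) = ww N τ (-ε) (-ζ) (ξ / N + ζ) := by
      rw [← ww_neg, neg_neg]; congr 1; rw [hξ']; field_simp
    have i4 : sumN N (fun α => ww N τ α ξ (ζ / N) * (om N (pg ε (α - γ)) * ww N τ ε ζ (ξ' / N))) =
      (om N (pg ε (-γ)) * ww N τ ε ζ (ξ' / N)) *
        sumN N (fun α => om N (pg α (-ε)) * ww N τ α ξ (ζ / N)) := by
      rw [← sumN_mul_left]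
      apply sumN_congr; intro α
      have : om N (pg ε (α - γ)) = om N (pg ε (-γ)) * om N (pg α (-ε)) := by
        rw [← om_add]; congr 1; simp [pg]; ring
      rw [this]; ring
    rw [i4, i3]
    linear_combination om N (pg ε (-γ)) * ww N τ (-ε) (-ζ) (ξ / N + ζ) * i1 +
      om N (pg ε (-γ)) * N * th τ ξ * i2
  apply mul_left_cancel₀ hn
  linear_combination key + th τ ξ' * key2

lemma cross {N : ℕ} (hN : 0 < N) {τ : ℂ} (hτ : 0 < τ.im) {ζ : ℂ} (hζ : th τ ζ ≠ 0)
    (γ : ℤ × ℤ) (ξ : ℂ) :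
    th τ ζ ^ 2 * sumN N (fun α => ww N τ α ξ (ζ / N) * ww N τ (α - γ) (-(ξ + N * ζ)) (ζ / N)) =
      cs N (-γ) * th τ ξ * th τ (-(ξ + N * ζ)) := by
  have hth := th_diff hτ
  set f : ℂ → ℂ := fun ξ => th τ ζ ^ 2 *
    sumN N (fun α => ww N τ α ξ (ζ / N) * ww N τ (α - γ) (-(ξ + N * ζ)) (ζ / N)) with hf
  set g : ℂ → ℂ := fun ξ => cs N (-γ) * th τ ξ * th τ (-(ξ + N * ζ)) with hg
  have fd : Differentiable ℂ f := by
    apply Differentiable.const_mul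
    refine sumN_diff (f := fun α ξ => ww N τ α ξ (ζ / N) * ww N τ (α - γ) (-(ξ + N * ζ)) (ζ / N)) ?_
    intro α
    have a1 := ww_diff (N := N) hτ (ζ / N) α
    have a2 : Differentiable ℂ (fun ξ => ww N τ (α - γ) (-(ξ + N * ζ)) (ζ / N)) :=
      (ww_diff (N := N) hτ (ζ / N) (α - γ)).comp (by fun_prop : Differentiable ℂ fun ξ : ℂ => -(ξ + N * ζ))
    exact a1.mul a2
  have gd : Differentiable ℂ g := by simp only [hg]; fun_prop
  have s1 : ∀ v, th τ v ≠ 0 → f v = g v := by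
    intro v hv
    refine eq_of_eq_off_zeros (G := fun ξ => th τ (ξ + N * ζ)) (by fun_prop) (ζ - N * ζ)
      (by simpa using hζ) fd.continuous.continuousAt gd.continuous.continuousAt ?_
    have := (hth.continuous.continuousAt (x := v)).eventually_ne hv
    filter_upwards [this.filter_mono nhdsWithin_le_nhds] with u hu hu2
    exact cross_aux hN hτ hζ γ u hu hu2
  exact eq_of_eq_off_zeros hth _ hζ fd.continuous.continuousAt gd.continuous.continuousAt
    (Filter.Eventually.of_forall s1)

/-- the unitarity sum -/
def KK (N : ℕ) (τ ζ : ℂ) (γ : ℤ × ℤ) (ξ : ℂ) : ℂ :=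
  sumN N (fun α => om N (pg α γ) * (ww N τ α ξ (ζ / N) * ww N τ (α - γ) (-ξ) (ζ / N)))

lemma KK_diff {N : ℕ} {τ : ℂ} (hτ : 0 < τ.im) (ζ : ℂ) (γ : ℤ × ℤ) :
    Differentiable ℂ (KK N τ ζ γ) := by
  refine sumN_diff (f := fun α ξ => om N (pg α γ) *
    (ww N τ α ξ (ζ / N) * ww N τ (α - γ) (-ξ) (ζ / N))) ?_
  intro α
  have a1 := ww_diff (N := N) hτ (ζ / N) α
  have a2 : Differentiable ℂ (fun ξ => ww N τ (α - γ) (-ξ) (ζ / N)) :=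
    (ww_diff (N := N) hτ (ζ / N) (α - γ)).comp (by fun_prop : Differentiable ℂ fun ξ : ℂ => -ξ)
  exact (a1.mul a2).const_mul _

lemma KK_one {N : ℕ} (τ ζ : ℂ) (γ : ℤ × ℤ) (ξ : ℂ) :
    KK N τ ζ γ (ξ + 1) = om N γ.1 * KK N τ ζ γ ξ := by
  unfold KK
  rw [← sumN_mul_left]
  apply sumN_congr; intro α
  have h1 := ww_xi_one (N := N) τ ξ (ζ / N) α
  have h2 := ww_xi_one (N := N) τ (-(ξ + 1)) (ζ / N) (α - γ)
  rw [show -(ξ + 1) + 1 = -ξ by ring] at h2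
  rw [h1, h2]
  have : om N α.1 = om N γ.1 * om N (α - γ).1 := by
    rw [← om_add]; congr 1; simp
  rw [this]; ring

lemma KK_tau {N : ℕ} (τ ζ : ℂ) (γ : ℤ × ℤ) (ξ : ℂ) :
    KK N τ ζ γ (ξ + τ) = (eπ (-2 * τ) * om N (-γ.2)) * eπ (-4 * ξ) * KK N τ ζ γ ξ := by
  unfold KK
  rw [← sumN_mul_left]
  apply sumN_congr; intro α
  have h1 := ww_xi_tau (N := N) τ ξ (ζ / N) α
  have h2 := ww_xi_tau (N := N) τ (-(ξ + τ)) (ζ / N) (α - γ)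
  rw [show -(ξ + τ) + τ = -ξ by ring] at h2
  rw [h1, h2]
  have : om N (-α.2) = om N (-γ.2) * om N (-(α - γ).2) := by
    rw [← om_add]; congr 1; simp only [Prod.snd_sub]; ring
  have e : eπ (-τ - 2 * (ζ / N) - 2 * ξ) =
      eπ (-2 * τ) * eπ (-4 * ξ) * eπ (-τ - 2 * (ζ / N) - 2 * -(ξ + τ)) := by
    rw [← eπ_add, ← eπ_add]; congr 1; ring
  rw [this, e]; ring

lemma KK_zero {N : ℕ} (hN : 0 < N) {τ : ℂ} (hτ : 0 < τ.im) {ζ : ℂ} (hζ : th τ ζ ≠ 0)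
    (γ : ℤ × ℤ) : KK N τ ζ γ 0 = cs N γ := by
  unfold KK cs
  apply sumN_congr; intro α
  rw [neg_zero, ww_zero _ _ _ (th_div_ne hN hτ hζ _), ww_zero _ _ _ (th_div_ne hN hτ hζ _)]
  ring

lemma KK_aa {N : ℕ} (hN : 0 < N) {τ : ℂ} (hτ : 0 < τ.im) {ζ : ℂ} (hζ : th τ ζ ≠ 0)
    (γ : ℤ × ℤ) : KK N τ ζ γ (- aa N τ γ) = eπ (-2 * γ.1 * aa N τ γ / N) * cs N γ := by
  unfold KK cs
  rw [← sumN_mul_left]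
  apply sumN_congr; intro α
  have h1 := th_div_ne hN hτ hζ α
  have h2 := th_div_ne hN hτ hζ (α - γ)
  simp only [ww]
  have e : aa N τ (α - γ) = aa N τ α - aa N τ γ := by
    rw [sub_eq_add_neg, aa_add, aa_neg]; ring
  rw [e] at h2 ⊢
  rw [show ζ / N + -aa N τ γ + aa N τ α = ζ / N + (aa N τ α - aa N τ γ) by ring,
    show ζ / N + - -aa N τ γ + (aa N τ α - aa N τ γ) = ζ / N + aa N τ α by ring]
  have e2 : eπ (2 * α.1 * -aa N τ γ / N) * eπ (2 * (α - γ).1 * - -aa N τ γ / N) =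
      eπ (-2 * γ.1 * aa N τ γ / N) := by
    rw [← eπ_add]; congr 1; simp only [Prod.fst_sub]; push_cast; ring
  rw [← e2]
  generalize th τ (ζ / N + aa N τ α) = u1 at *
  generalize th τ (ζ / N + (aa N τ α - aa N τ γ)) = u2 at *
  generalize eπ (2 * α.1 * -aa N τ γ / N) = u3 at *
  generalize eπ (2 * (α - γ).1 * - -aa N τ γ / N) = u4 at *
  field_simp

lemma sumN_mul_right {N : ℕ} (c : ℂ) (f : ℤ × ℤ → ℂ) :
    sumN N (fun α => f α * c) = sumN N f * c := by
  unfold sumN; rw [Finset.sum_mul]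

lemma KK_zeta {N : ℕ} (hN : 0 < N) {τ : ℂ} (hτ : 0 < τ.im) {ζ : ℂ} (hζ : th τ ζ ≠ 0)
    (γ : ℤ × ℤ) : KK N τ ζ γ ζ = 0 := by
  have hn := castN hN
  set u : ℤ × ℤ → ℂ := fun α => ww N τ α ζ (ζ / N) with hu
  set v : ℤ × ℤ → ℂ := fun α => ww N τ α (-ζ) (ζ / N) with hv
  have U : ∀ α, N * u α = sumN N (fun β => om N (pg β α) * u β) := by
    intro α
    have := I1 hN hτ α ζ ζ hζ (th_div_ne hN hτ hζ _)
    apply mul_left_cancel₀ hζ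
    rw [this]; simp only [hu]; ring
  have V : ∀ α, N * v α = - sumN N (fun β => om N (pg β (-α)) * v β) := by
    intro α
    have h0 : th τ (-ζ) ≠ 0 := by rw [th_neg]; simpa using hζ
    have := I1 hN hτ (-α) (-ζ) ζ hζ (th_div_ne hN hτ h0 _)
    rw [th_neg, neg_div, ww_neg] at this
    apply mul_left_cancel₀ hζ
    simp only [hv]; linear_combination this
  have hK : KK N τ ζ γ ζ = sumN N (fun α => om N (pg α γ) * (u α * v (α - γ))) := rfl
  rw [hK]
  set S := sumN N (fun α => om N (pg α γ) * (u α * v (α - γ))) with hS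
  have e1 : (N : ℂ) ^ 2 * S = - sumN N (fun α => sumN N (fun β => sumN N (fun δ =>
      om N (pg α γ) * ((om N (pg β α) * u β) * (om N (pg δ (-(α - γ))) * v δ))))) := by
    rw [hS, ← sumN_mul_left, neg_eq_neg_one_mul, ← sumN_mul_left]
    apply sumN_congr; intro α
    simp only [sumN_mul_left]
    rw [sumN_mul_right]
    have h1 := U α
    have h2 := V (α - γ)
    linear_combination om N (pg α γ) * N * v (α - γ) * h1 + om N (pg α γ) *
      sumN N (fun β => om N (pg β α) * u β) * h2
  have e2 : sumN N (fun α => sumN N (fun β => sumN N (fun δ =>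
      om N (pg α γ) * ((om N (pg β α) * u β) * (om N (pg δ (-(α - γ))) * v δ))))) =
      (N : ℂ) ^ 2 * S := by
    rw [sumN_comm, hS, ← sumN_mul_left]
    apply sumN_congr; intro β
    rw [sumN_comm]
    have s1 : ∀ δ, sumN N (fun α => om N (pg α γ) *
        ((om N (pg β α) * u β) * (om N (pg δ (-(α - γ))) * v δ))) =
        u β * ((om N (pg δ γ) * v δ) * cs N (δ + (γ - β))) := by
      intro δ
      rw [cs, ← sumN_mul_left, ← sumN_mul_left]
      apply sumN_congr; intro α
      have : om N (pg α γ) * om N (pg β α) * om N (pg δ (-(α - γ))) =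
        om N (pg δ γ) * om N (pg α (δ + (γ - β))) := by
        rw [← om_add, ← om_add, ← om_add]; congr 1; simp [pg]; ring
      linear_combination u β * v δ * this
    simp only [s1]
    rw [sumN_mul_left]
    have per : Per N (fun δ => (om N (pg δ γ) * v δ) * cs N (δ + (γ - β))) :=
      ((per_om hN γ).mul (ww_per hN τ (-ζ) (ζ / N))).mul ((cs_per hN).shift (γ - β))
    rw [← sumN_shift per (β - γ), sumN_single hN]
    · rw [show (0 : ℤ × ℤ) + (β - γ) + (γ - β) = 0 by abel, cs_zero,
        show (0 : ℤ × ℤ) + (β - γ) = β - γ by abel]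
      have : pg (β - γ) γ = pg β γ := by simp [pg]; ring
      rw [this]; ring
    · intro δ hδ
      rw [show δ + (β - γ) + (γ - β) = δ by abel, cs, char_sum hN hδ, mul_zero]
  have e3 : (N : ℂ) ^ 2 * S = 0 := by
    rw [e2] at e1
    linear_combination e1 / 2
  exact (mul_eq_zero.1 e3).resolve_left (pow_ne_zero _ hn)

lemma th_nsmul {τ : ℂ} (hτ : 0 < τ.im) (k : ℕ) {u : ℂ} (h : th τ (k * u) ≠ 0) : th τ u ≠ 0 := by
  intro h0
  obtain ⟨m, n, rfl⟩ := th_eq_zero hτ h h0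
  apply h
  have := th_lat τ (k * m) (k * n)
  rw [← this]; congr 1; push_cast; ring

lemma unit_aux {N : ℕ} (hN : 0 < N) {τ : ℂ} (hτ : 0 < τ.im) {ζ : ℂ} (hζ : th τ ζ ≠ 0)
    (h2 : th τ ((2 * N : ℕ) * ζ) ≠ 0)
    (γ : ℤ × ℤ) (hγ : γ = 0 ∨ ¬ ((N : ℤ) ∣ γ.1 ∧ (N : ℤ) ∣ γ.2)) (ξ : ℂ) :
    th τ ζ ^ 2 * KK N τ ζ γ ξ = cs N γ * (th τ (ζ + ξ) * th τ (ζ - ξ)) := by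
  have hn := castN hN
  have hth := th_diff hτ
  have hKd := KK_diff (N := N) hτ ζ γ
  rcases hγ with rfl | hγ
  · set F : ℂ → ℂ := fun ξ => th τ ζ ^ 2 * KK N τ ζ 0 ξ -
      cs N 0 * (th τ (ζ + ξ) * th τ (ζ - ξ)) with hF
    have hFd : Differentiable ℂ F := by simp only [hF]; fun_prop
    have z2 : th τ (2 * ζ) ≠ 0 := th_nsmul hτ N (by convert h2 using 2; push_cast; ring)
    have e : KK N τ ζ 0 (-ζ) = KK N τ ζ 0 ζ := by
      unfold KK; apply sumN_congr; intro α; simp only [sub_zero, neg_neg]; ring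
    have := deg_two_zero hτ hζ hFd (om_ne N (0 : ℤ × ℤ).1)
      (mul_ne_zero (eπ_ne (-2 * τ)) (om_ne N (-(0 : ℤ × ℤ).2)))
      (fun y => by
        simp only [hF, KK_one]
        have a1 := th_add_one τ (ζ + y)
        have a2 := th_add_one τ (ζ - (y + 1))
        rw [show ζ - (y + 1) + 1 = ζ - y by ring] at a2
        rw [← add_assoc, a1, a2]; simp [om_zero])
      (fun y => by
        simp only [hF, KK_tau]
        have a1 := th_add_tau τ (ζ + y)
        have a2 := th_add_tau τ (ζ - (y + τ))
        rw [show ζ - (y + τ) + τ = ζ - y by ring] at a2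
        rw [← add_assoc, a1, a2]
        have e : eπ (-τ - 2 * (ζ + y)) =
          eπ (-2 * τ) * eπ (-4 * y) * eπ (-τ - 2 * (ζ - (y + τ))) := by
          rw [← eπ_add, ← eπ_add]; congr 1; ring
        rw [e]; simp [om_zero]; ring)
      (a := 0) (b := ζ) (c := -ζ)
      (by simp only [hF]; rw [KK_zero hN hτ hζ]; simp; ring)
      (by simp only [hF]; rw [KK_zeta hN hτ hζ]; simp [th_zero])
      (by simp only [hF]; rw [e, KK_zeta hN hτ hζ]; simp [th_zero])
      (by simpa using hζ) (by rw [sub_zero, th_neg]; simpa using hζ)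
      (by rw [show -ζ - ζ = -(2 * ζ) by ring, th_neg]; simpa using z2) ξ
    simp only [hF] at this
    linear_combination this
  · have c0 : cs N γ = 0 := char_sum hN hγ
    have zN : th τ (N * ζ) ≠ 0 := th_nsmul hτ 2 (by convert h2 using 2; push_cast; ring)
    have ha : th τ (- aa N τ γ) ≠ 0 := by
      rw [th_neg]; intro h; exact hγ (th_aa hN hτ hζ (by simpa using h))
    rw [deg_two_zero hτ hζ hKd (om_ne N γ.1) (mul_ne_zero (eπ_ne (-2 * τ)) (om_ne N (-γ.2)))
      (KK_one τ ζ γ) (KK_tau τ ζ γ) (a := 0) (b := - aa N τ γ) (c := ζ)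
      (by rw [KK_zero hN hτ hζ, c0]) (by rw [KK_aa hN hτ hζ, c0, mul_zero]) (KK_zeta hN hτ hζ γ)
      (by simpa using ha) (by simpa using hζ)
      (by have := th_div_ne hN hτ zN γ
          rwa [show N * ζ / N + aa N τ γ = ζ - -aa N τ γ by field_simp; ring] at this) ξ, c0]
    ring

lemma ww_x_cont {N : ℕ} (hN : 0 < N) {τ : ℂ} (hτ : 0 < τ.im) {ζ : ℂ} (hζ : th τ ζ ≠ 0)
    (α : ℤ × ℤ) (ξ : ℂ) : ContinuousAt (fun ζ : ℂ => ww N τ α ξ (ζ / N)) ζ := by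
  have hth := (th_diff hτ).continuous
  simp only [ww]
  apply ContinuousAt.mul continuousAt_const
  apply ContinuousAt.div
  · fun_prop
  · fun_prop
  · exact th_div_ne hN hτ hζ α

lemma unitarity {N : ℕ} (hN : 0 < N) {τ : ℂ} (hτ : 0 < τ.im) {ζ : ℂ} (hζ : th τ ζ ≠ 0)
    (γ : ℤ × ℤ) (hγ : γ = 0 ∨ ¬ ((N : ℤ) ∣ γ.1 ∧ (N : ℤ) ∣ γ.2)) (ξ : ℂ) :
    th τ ζ ^ 2 * KK N τ ζ γ ξ = cs N γ * (th τ (ζ + ξ) * th τ (ζ - ξ)) := by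
  have hth := th_diff hτ
  have hthc := hth.continuous
  have hn := castN hN
  refine eq_of_eq_off_zeros (f := fun ζ => th τ ζ ^ 2 * KK N τ ζ γ ξ)
    (g := fun ζ => cs N γ * (th τ (ζ + ξ) * th τ (ζ - ξ))) (G := fun ζ => th τ ((2 * N : ℕ) * ζ))
    (by fun_prop) (ζ / (2 * N : ℕ)) ?_ ?_ (by fun_prop) ?_
  · have : ((2 * N : ℕ) : ℂ) * (ζ / (2 * N : ℕ)) = ζ := by
      push_cast; field_simp
    simpa only [this] using hζ
  · apply ContinuousAt.mul (by fun_prop)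
    unfold KK sumN
    apply tendsto_finsetSum
    intro α _
    apply ContinuousAt.mul continuousAt_const
    exact (ww_x_cont hN hτ hζ _ _).mul (ww_x_cont hN hτ hζ _ _)
  · have := (hthc.continuousAt (x := ζ)).eventually_ne hζ
    filter_upwards [this.filter_mono nhdsWithin_le_nhds] with u hu hu2
    exact unit_aux hN hτ hu hu2 γ hγ ξ

lemma sumN_single' {M : Type*} [AddCommMonoid M] {N : ℕ} (hN : 0 < N) (f : ℤ × ℤ → M)
    (h : ∀ α : ℤ × ℤ, ¬ ((N : ℤ) ∣ α.1 ∧ (N : ℤ) ∣ α.2) → f α = 0) : sumN N f = f 0 := by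
  unfold sumN
  rw [Finset.sum_eq_single ((⟨0, hN⟩, ⟨0, hN⟩) : Fin N × Fin N)]
  · simp; rfl
  · intro b _ hb
    apply h
    intro h'
    have := fin_pair_zero h'
    exact hb (Prod.ext (Fin.ext this.1) (Fin.ext this.2))
  · simp

lemma dvd_add_N {N : ℕ} (a b : ℤ) (h : a = b + N) : (N : ℤ) ∣ a ↔ (N : ℤ) ∣ b := by
  subst h; simp

lemma dvd_sub_N {N : ℕ} (a b : ℤ) (h : a = b - N) : (N : ℤ) ∣ a ↔ (N : ℤ) ∣ b := by
  subst h; simp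

lemma sumN_ite {N : ℕ} (hN : 0 < N) {f : ℤ × ℤ → ℂ} (hf : Per N f) (k : ℤ × ℤ) :
    sumN N (fun e => if (N : ℤ) ∣ e.1 - k.1 ∧ (N : ℤ) ∣ e.2 - k.2 then f e else 0) = f k := by
  have per : Per N (fun e : ℤ × ℤ => if (N : ℤ) ∣ e.1 - k.1 ∧ (N : ℤ) ∣ e.2 - k.2 then f e else 0) := by
    intro a b
    simp only [(hf a b).1, (hf a b).2, dvd_add_N (N := N) (a + N - k.1) (a - k.1) (by ring),
      dvd_add_N (N := N) (b + N - k.2) (b - k.2) (by ring), and_self]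
  rw [← sumN_shift per k, sumN_single hN]
  · simp
  · intro α hα
    simp [hα]

lemma sum1_ite {N : ℕ} (hN : 0 < N) {f : ℤ → ℂ} (hf : ∀ a, f (a + N) = f a) (k : ℤ) :
    ∑ e : Fin N, (if (N : ℤ) ∣ ((e : ℕ) : ℤ) - k then f (e : ℕ) else 0) = f k := by
  have := sumN_ite hN (f := fun e => f e.1) (fun a b => ⟨hf a, rfl⟩) (k, 0)
  simp only [sumN, Fintype.sum_prod_type, sub_zero] at this
  rw [← this]
  congr 1; ext e
  rw [Finset.sum_eq_single (⟨0, hN⟩ : Fin N)]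
  · simp
  · intro b _ hb
    have : ¬ ((N : ℤ) ∣ ((b : ℕ) : ℤ)) := by
      rw [Int.natCast_dvd_natCast]
      intro h
      exact hb (Fin.ext (Nat.eq_zero_of_dvd_of_lt h b.2))
    simp [this]
  · simp

lemma fin_dvd {N : ℕ} (a b : Fin N) : (N : ℤ) ∣ ((b : ℕ) : ℤ) - ((a : ℕ) : ℤ) ↔ a = b := by
  constructor
  · intro h
    have h1 := a.2
    have h2 := b.2
    apply Fin.ext
    have := Int.eq_zero_of_abs_lt_dvd h (by rw [abs_lt]; constructor <;> omega)
    omega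
  · rintro rfl; simp

lemma gMat_pow (N n : ℕ) : gMat N ^ n = Matrix.diagonal fun j : Fin N => om N (n * (((j : ℕ) : ℤ) + 1)) := by
  rw [gMat, Matrix.diagonal_pow]
  congr 1; ext j
  rw [Pi.pow_apply, ← eπ_nat_mul, om]; congr 1; push_cast; ring

lemma hMat_pow {N : ℕ} (hN : 0 < N) (n : ℕ) (j l : Fin N) :
    (hMat N ^ n) j l = if (N : ℤ) ∣ ((l : ℕ) : ℤ) - ((j : ℕ) : ℤ) - n then 1 else 0 := by
  have hh : ∀ j l : Fin N, hMat N j l = if (N : ℤ) ∣ ((l : ℕ) : ℤ) - ((j : ℕ) : ℤ) - 1 then 1 else 0 := by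
    intro j l
    simp only [hMat, Matrix.of_apply]
    congr 1
    rw [eq_iff_iff]
    have hl := l.2
    have : ((N : ℤ) ∣ ((l : ℕ) : ℤ) - ((j : ℕ) : ℤ) - 1) ↔ ((j : ℕ) + 1) % N = (l : ℕ) % N := by
      rw [← Nat.ModEq, Nat.modEq_iff_dvd]
      rw [show ((l : ℕ) : ℤ) - (((j : ℕ) + 1 : ℕ) : ℤ) = ((l : ℕ) : ℤ) - ((j : ℕ) : ℤ) - 1 by
        push_cast; ring]
    rw [this, Nat.mod_eq_of_lt hl, eq_comm]
  induction n generalizing l with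
  | zero =>
    rw [pow_zero, Matrix.one_apply]
    simp only [Nat.cast_zero, sub_zero, fin_dvd]
  | succ n ih =>
    rw [pow_succ, Matrix.mul_apply]
    simp only [ih, hh, ite_mul, zero_mul, one_mul, sub_sub]
    rw [sum1_ite hN (f := fun e => if (N : ℤ) ∣ ((l : ℕ) : ℤ) - (e + 1) then 1 else 0)
      (fun a => by simp only [dvd_sub_N (N := N) (((l : ℕ) : ℤ) - (a + N + 1)) (((l : ℕ) : ℤ) - (a + 1)) (by ring)])]
    push_cast
    simp only [add_assoc]

lemma Imat_apply {N : ℕ} (hN : 0 < N) (α : Fin N × Fin N) (j l : Fin N) :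
    Imat N α j l = if (N : ℤ) ∣ ((l : ℕ) : ℤ) - ((j : ℕ) : ℤ) - ((α.1 : ℕ) : ℤ)
      then om N (((α.2 : ℕ) : ℤ) * (((j : ℕ) : ℤ) + 1)) else 0 := by
  rw [Imat, gMat_pow, Matrix.diagonal_mul, hMat_pow hN]
  simp

lemma Imat_inv {N : ℕ} (hN : 0 < N) (α : Fin N × Fin N) :
    (Imat N α)⁻¹ = Matrix.of fun (j l : Fin N) =>
      if (N : ℤ) ∣ ((l : ℕ) : ℤ) - ((j : ℕ) : ℤ) + ((α.1 : ℕ) : ℤ)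
      then om N (-(((α.2 : ℕ) : ℤ) * (((l : ℕ) : ℤ) + 1))) else 0 := by
  apply Matrix.inv_eq_right_inv
  ext j l
  rw [Matrix.mul_apply]
  simp only [Imat_apply hN, Matrix.of_apply, ite_mul, zero_mul, sub_sub]
  rw [sum1_ite hN (f := fun e => om N (((α.2 : ℕ) : ℤ) * (((j : ℕ) : ℤ) + 1)) *
    if (N : ℤ) ∣ ((l : ℕ) : ℤ) - e + ((α.1 : ℕ) : ℤ)
      then om N (-(((α.2 : ℕ) : ℤ) * (((l : ℕ) : ℤ) + 1))) else 0)
    (fun a => by simp only [dvd_sub_N (N := N) (((l : ℕ) : ℤ) - (a + N) + ((α.1 : ℕ) : ℤ))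
      (((l : ℕ) : ℤ) - a + ((α.1 : ℕ) : ℤ)) (by ring)])]
  rw [show ((l : ℕ) : ℤ) - (((j : ℕ) : ℤ) + ((α.1 : ℕ) : ℤ)) + ((α.1 : ℕ) : ℤ) =
    ((l : ℕ) : ℤ) - ((j : ℕ) : ℤ) by ring]
  simp only [fin_dvd, Matrix.one_apply]
  split_ifs with h
  · subst h; rw [mul_comm, om_neg_mul]
  · simp

/-- the matrices `I ⊗ I⁻¹` -/
def Jm (N : ℕ) (α : ℤ × ℤ) : Matrix (Fin N × Fin N) (Fin N × Fin N) ℂ :=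
  Matrix.of fun a b =>
    if (N : ℤ) ∣ ((b.1 : ℕ) : ℤ) - (((a.1 : ℕ) : ℤ) + α.1) ∧
        (N : ℤ) ∣ ((b.2 : ℕ) : ℤ) - (((a.2 : ℕ) : ℤ) - α.1)
    then om N (α.2 * (((a.1 : ℕ) : ℤ) - ((b.2 : ℕ) : ℤ))) else 0

lemma Jm_eq {N : ℕ} (hN : 0 < N) (α : Fin N × Fin N) :
    Imat N α ⊗ₖ (Imat N α)⁻¹ = Jm N (((α.1 : ℕ) : ℤ), ((α.2 : ℕ) : ℤ)) := by
  ext ⟨a, b⟩ ⟨c, d⟩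
  rw [Matrix.kroneckerMap_apply, Imat_inv hN, Imat_apply hN, Jm]
  simp only [Matrix.of_apply, ← sub_sub, ← sub_add]
  have e : om N (((α.2 : ℕ) : ℤ) * (((a : ℕ) : ℤ) - ((d : ℕ) : ℤ))) =
      om N (((α.2 : ℕ) : ℤ) * (((a : ℕ) : ℤ) + 1)) *
        om N (-(((α.2 : ℕ) : ℤ) * (((d : ℕ) : ℤ) + 1))) := by
    rw [← om_add]; congr 1; ring
  rw [e]
  split_ifs <;> simp_all

lemma Jm_per {N : ℕ} (hN : 0 < N) : Per N (Jm N) := by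
  intro p q
  constructor
  · ext a b
    simp only [Jm, Matrix.of_apply]
    simp only [dvd_sub_N (N := N) (((b.1 : ℕ) : ℤ) - (((a.1 : ℕ) : ℤ) + (p + N))) (((b.1 : ℕ) : ℤ) - (((a.1 : ℕ) : ℤ) + p)) (by ring),
      dvd_add_N (N := N) (((b.2 : ℕ) : ℤ) - (((a.2 : ℕ) : ℤ) - (p + N))) (((b.2 : ℕ) : ℤ) - (((a.2 : ℕ) : ℤ) - p)) (by ring)]
  · ext a b
    simp only [Jm, Matrix.of_apply]
    rw [om_congr hN (a := (q + N) * _) (b := q * (((a.1 : ℕ) : ℤ) - ((b.2 : ℕ) : ℤ))) ⟨((a.1 : ℕ) : ℤ) - ((b.2 : ℕ) : ℤ), by ring⟩]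

lemma Jm_zero {N : ℕ} : Jm N 0 = 1 := by
  ext ⟨a, b⟩ ⟨c, d⟩
  simp only [Jm, Matrix.of_apply, Prod.fst_zero, Prod.snd_zero, add_zero, sub_zero, fin_dvd,
    Matrix.one_apply, Prod.mk.injEq, zero_mul, om_zero]

lemma Jm_mul {N : ℕ} (hN : 0 < N) (α β : ℤ × ℤ) :
    Jm N α * Jm N β = om N (pg α β) • Jm N (α + β) := by
  ext ⟨a, b⟩ ⟨c, d⟩
  rw [Matrix.mul_apply, Matrix.smul_apply]
  simp only [Jm, Matrix.of_apply, ite_mul, zero_mul, Prod.fst_add, Prod.snd_add, smul_eq_mul]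
  have := sumN_ite hN (f := fun e => om N (α.2 * (((a : ℕ) : ℤ) - e.2)) *
      (if (N : ℤ) ∣ ((c : ℕ) : ℤ) - (e.1 + β.1) ∧ (N : ℤ) ∣ ((d : ℕ) : ℤ) - (e.2 - β.1)
        then om N (β.2 * (e.1 - ((d : ℕ) : ℤ))) else 0))
    (fun p q => by
      constructor
      · simp only [dvd_sub_N (N := N) (((c : ℕ) : ℤ) - (p + N + β.1)) (((c : ℕ) : ℤ) - (p + β.1)) (by ring)]
        rw [om_congr hN (a := β.2 * (p + N - ((d : ℕ) : ℤ))) (b := β.2 * (p - ((d : ℕ) : ℤ))) ⟨β.2, by ring⟩]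
      · simp only [dvd_sub_N (N := N) (((d : ℕ) : ℤ) - (q + N - β.1)) (((d : ℕ) : ℤ) - (q - β.1)) (by ring)]
        rw [om_congr hN (a := α.2 * (((a : ℕ) : ℤ) - (q + N))) (b := α.2 * (((a : ℕ) : ℤ) - q)) ⟨-α.2, by ring⟩])
    (((a : ℕ) : ℤ) + α.1, ((b : ℕ) : ℤ) - α.1)
  rw [sumN] at this
  rw [this]
  simp only
  rw [show ((a : ℕ) : ℤ) + α.1 + β.1 = ((a : ℕ) : ℤ) + (α.1 + β.1) by ring,
    show ((b : ℕ) : ℤ) - α.1 - β.1 = ((b : ℕ) : ℤ) - (α.1 + β.1) by ring]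
  split_ifs with h
  · obtain ⟨k, hk⟩ := h.2
    rw [← om_add, ← om_add]
    apply om_congr hN
    refine ⟨α.2 * k, ?_⟩
    simp only [pg]
    linear_combination α.2 * hk
  · simp

lemma pt2_Jm_mul {N : ℕ} (hN : 0 < N) (α β : ℤ × ℤ) :
    pt2 (Jm N α) * pt2 (Jm N β) = pt2 (Jm N (α + β)) := by
  ext ⟨a, b⟩ ⟨c, d⟩
  rw [Matrix.mul_apply]
  simp only [pt2, Jm, Matrix.of_apply, ite_mul, zero_mul, Prod.fst_add, Prod.snd_add]
  have sw : ∀ e : Fin N × Fin N, ((N : ℤ) ∣ ((b : ℕ) : ℤ) - (((e.2 : ℕ) : ℤ) - α.1)) ↔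
      ((N : ℤ) ∣ ((e.2 : ℕ) : ℤ) - (((b : ℕ) : ℤ) + α.1)) := by
    intro e
    rw [← dvd_neg]; congr! 1; ring
  simp only [sw]
  have := sumN_ite hN (f := fun e => om N (α.2 * (((a : ℕ) : ℤ) - ((b : ℕ) : ℤ))) *
      (if (N : ℤ) ∣ ((c : ℕ) : ℤ) - (e.1 + β.1) ∧ (N : ℤ) ∣ e.2 - (((d : ℕ) : ℤ) - β.1)
        then om N (β.2 * (e.1 - e.2)) else 0))
    (fun p q => by
      constructor
      · simp only [dvd_sub_N (N := N) (((c : ℕ) : ℤ) - (p + N + β.1)) (((c : ℕ) : ℤ) - (p + β.1)) (by ring)]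
        rw [om_congr hN (a := β.2 * (p + N - q)) (b := β.2 * (p - q)) ⟨β.2, by ring⟩]
      · simp only [dvd_add_N (N := N) (q + N - (((d : ℕ) : ℤ) - β.1)) (q - (((d : ℕ) : ℤ) - β.1)) (by ring)]
        rw [om_congr hN (a := β.2 * (p - (q + N))) (b := β.2 * (p - q)) ⟨-β.2, by ring⟩])
    (((a : ℕ) : ℤ) + α.1, ((b : ℕ) : ℤ) + α.1)
  rw [sumN] at this
  rw [this]
  simp only
  rw [show ((a : ℕ) : ℤ) + α.1 + β.1 = ((a : ℕ) : ℤ) + (α.1 + β.1) by ring,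
    show ((b : ℕ) : ℤ) + α.1 - (((d : ℕ) : ℤ) - β.1) = ((b : ℕ) : ℤ) - (((d : ℕ) : ℤ) - (α.1 + β.1)) by ring]
  rw [mul_ite, mul_zero]
  congr 1
  rw [← om_add]; congr 1; ring

lemma pt2_one {N : ℕ} : pt2 (1 : Matrix (Fin N × Fin N) (Fin N × Fin N) ℂ) = 1 := by
  ext ⟨a, b⟩ ⟨c, d⟩
  simp only [pt2, Matrix.of_apply, Matrix.one_apply, Prod.mk.injEq, eq_comm (a := d)]

lemma pt2_smul {N : ℕ} (c : ℂ) (M : Matrix (Fin N × Fin N) (Fin N × Fin N) ℂ) :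
    pt2 (c • M) = c • pt2 M := by
  ext ⟨a, b⟩ ⟨c, d⟩; simp [pt2]

lemma pt2_sumN {N : ℕ} (f : ℤ × ℤ → Matrix (Fin N × Fin N) (Fin N × Fin N) ℂ) :
    pt2 (sumN N f) = sumN N (fun α => pt2 (f α)) := by
  ext ⟨a, b⟩ ⟨c, d⟩; simp [pt2, sumN, Matrix.sum_apply]

lemma conv_sum {N : ℕ} (hN : 0 < N) (M : ℤ × ℤ → Matrix (Fin N × Fin N) (Fin N × Fin N) ℂ)
    (hMp : Per N M) (hM0 : M 0 = 1) (φ : ℤ × ℤ → ℤ × ℤ → ℂ)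
    (hM : ∀ α β, M α * M (-β) = φ α β • M (α - β)) (u v : ℤ × ℤ → ℂ) (hv : Per N v) (c : ℂ)
    (hne : ∀ γ : ℤ × ℤ, ¬ ((N : ℤ) ∣ γ.1 ∧ (N : ℤ) ∣ γ.2) →
      sumN N (fun α => φ α (α - γ) * (u α * v (α - γ))) = 0)
    (h0 : sumN N (fun α => φ α (α - 0) * (u α * v (α - 0))) = c) :
    sumN N (fun α => u α • M α) * sumN N (fun β => v β • M (-β)) = c • 1 := by
  have e1 : sumN N (fun α => u α • M α) * sumN N (fun β => v β • M (-β)) =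
      sumN N (fun α => sumN N (fun β => (u α * v β) • (M α * M (-β)))) := by
    simp only [sumN, Finset.sum_mul_sum]
    congr 1; ext1 i; congr 1; ext1 j
    rw [smul_mul_smul_comm]
  have e2 : ∀ α, sumN N (fun β => (u α * v β) • (M α * M (-β))) =
      sumN N (fun γ => (φ α (α - γ) * (u α * v (α - γ))) • M γ) := by
    intro α
    have per : Per N (fun β => (u α * v β) • (M α * M (-β))) := by
      have h1 := hMp.neg
      intro a b
      constructor
      · simp only [(hv a b).1, (h1 a b).1]
      · simp only [(hv a b).2, (h1 a b).2]
    rw [← sumN_shift per α, ← sumN_neg (per.shift α)]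
    apply sumN_congr; intro γ
    rw [hM, show -γ + α = α - γ by abel, show α - (α - γ) = γ by abel, smul_smul, mul_comm]
  rw [e1]
  simp only [e2]
  rw [sumN_comm]
  have e3 : ∀ γ, sumN N (fun α => (φ α (α - γ) * (u α * v (α - γ))) • M γ) =
      (sumN N (fun α => φ α (α - γ) * (u α * v (α - γ)))) • M γ := by
    intro γ
    simp only [sumN, Finset.sum_smul]
  simp only [e3]
  rw [sumN_single' hN]
  · rw [h0, hM0]
  · intro γ hγ; rw [hne γ hγ, zero_smul]

/-- unnormalized matrix -/
def AA (N : ℕ) (τ ζ ξ : ℂ) : Matrix (Fin N × Fin N) (Fin N × Fin N) ℂ :=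
  sumN N (fun α => ww N τ α ξ (ζ / N) • Jm N α)
/-- its flipped version -/
def BB (N : ℕ) (τ ζ ξ : ℂ) : Matrix (Fin N × Fin N) (Fin N × Fin N) ℂ :=
  sumN N (fun α => ww N τ α ξ (ζ / N) • Jm N (-α))

lemma AA_unit {N : ℕ} (hN : 0 < N) {τ : ℂ} (hτ : 0 < τ.im) {ζ : ℂ} (hζ : th τ ζ ≠ 0) (η : ℂ) :
    AA N τ ζ η * BB N τ ζ (-η) =
      ((N : ℂ) ^ 2 * (th τ (ζ + η) * th τ (ζ - η)) / th τ ζ ^ 2) • 1 := by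
  have hz2 := pow_ne_zero 2 hζ
  have eqK : ∀ γ, sumN N (fun α => om N (pg α (-(α - γ))) *
      (ww N τ α η (ζ / N) * ww N τ (α - γ) (-η) (ζ / N))) = KK N τ ζ γ η := by
    intro γ
    apply sumN_congr; intro α
    congr 2; simp [pg]; ring
  refine conv_sum hN (Jm N) (Jm_per hN) Jm_zero (fun α β => om N (pg α (-β)))
    (fun α β => by rw [Jm_mul hN, sub_eq_add_neg]) _ _ (ww_per hN _ _ _) _ ?_ ?_
  · intro γ hγ
    rw [eqK]
    have := unitarity hN hτ hζ γ (Or.inr hγ) η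
    rw [cs, char_sum hN hγ, zero_mul] at this
    exact (mul_eq_zero.1 this).resolve_left hz2
  · rw [eqK]
    have := unitarity hN hτ hζ 0 (Or.inl rfl) η
    rw [cs_zero] at this
    rw [eq_div_iff hz2]; linear_combination this

lemma AA_cross {N : ℕ} (hN : 0 < N) {τ : ℂ} (hτ : 0 < τ.im) {ζ : ℂ} (hζ : th τ ζ ≠ 0) (ξ : ℂ) :
    pt2 (AA N τ ζ ξ) * pt2 (BB N τ ζ (-(ξ + N * ζ))) =
      ((N : ℂ) ^ 2 * (th τ ξ * th τ (-(ξ + N * ζ))) / th τ ζ ^ 2) • 1 := by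
  have hz2 := pow_ne_zero 2 hζ
  rw [AA, BB, pt2_sumN, pt2_sumN]
  simp only [pt2_smul]
  refine conv_sum hN (fun α => pt2 (Jm N α)) (fun a b => ?_) (by rw [Jm_zero, pt2_one])
    (fun α β => 1)
    (fun α β => by rw [pt2_Jm_mul hN, sub_eq_add_neg, one_smul]) _ _ (ww_per hN _ _ _) _ ?_ ?_
  · have := Jm_per hN a b
    simp only [this.1, this.2, and_self]
  · intro γ hγ
    have := cross hN hτ hζ γ ξ
    rw [cs, char_sum hN (ndvd_neg hγ), zero_mul, zero_mul] at this
    simp only [one_mul]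
    exact (mul_eq_zero.1 this).resolve_left hz2
  · have := cross hN hτ hζ 0 ξ
    rw [neg_zero, cs_zero] at this
    simp only [one_mul]
    rw [eq_div_iff hz2]; linear_combination this

lemma Wcoef_eq {N : ℕ} (α : Fin N × Fin N) (ξ ζ τ : ℂ) :
    Wcoef N α ξ ζ τ = (1 / N : ℂ) * ww N τ (((α.1 : ℕ) : ℤ), ((α.2 : ℕ) : ℤ)) ξ (ζ / N) := by
  rw [Wcoef, jTheta_char, jTheta_char, ww, aa]
  push_cast
  have e1 : ξ + ζ / N + (α.1 : ℕ) / N * τ + (α.2 : ℕ) / N =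
    ζ / N + ξ + ((α.1 : ℕ) * τ + (α.2 : ℕ)) / N := by ring
  have e2 : ζ / N + (α.1 : ℕ) / N * τ + (α.2 : ℕ) / N =
    ζ / N + (((α.1 : ℕ) : ℂ) * τ + (α.2 : ℕ)) / N := by ring
  rw [e1, e2]
  have e3 : eπ ((((α.1 : ℕ) : ℂ) / N) ^ 2 * τ + 2 * (((α.1 : ℕ) : ℂ) / N) * (ξ + ζ / N + 1 / 2 + ((α.2 : ℕ) : ℂ) / N)) =
    eπ (2 * ((α.1 : ℕ) : ℂ) * ξ / N) * eπ ((((α.1 : ℕ) : ℂ) / N) ^ 2 * τ + 2 * (((α.1 : ℕ) : ℂ) / N) * (ζ / N + 1 / 2 + ((α.2 : ℕ) : ℂ) / N)) := by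
    rw [← eπ_add]; congr 1; ring
  rw [e3]
  have n0 := eπ_ne ((((α.1 : ℕ) : ℂ) / N) ^ 2 * τ + 2 * (((α.1 : ℕ) : ℂ) / N) * (ζ / N + 1 / 2 + ((α.2 : ℕ) : ℂ) / N))
  generalize eπ ((((α.1 : ℕ) : ℂ) / N) ^ 2 * τ + 2 * (((α.1 : ℕ) : ℂ) / N) * (ζ / N + 1 / 2 + ((α.2 : ℕ) : ℂ) / N)) = E at *
  generalize th τ (ζ / N + ξ + ((α.1 : ℕ) * τ + (α.2 : ℕ)) / N) = t1
  generalize th τ (ζ / N + (((α.1 : ℕ) : ℂ) * τ + (α.2 : ℕ)) / N) = t2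
  generalize eπ (2 * ((α.1 : ℕ) : ℂ) * ξ / N) = t3
  rw [mul_left_comm (N : ℂ), mul_assoc, mul_left_comm t3, mul_div_mul_left _ _ n0]
  rw [div_eq_mul_inv, div_eq_mul_inv, mul_inv]; ring

/-- scalar prefactor -/
def cc (N : ℕ) (ξ ζ τ : ℂ) : ℂ :=
  eπ (ξ * (2 / N - 2)) * (kappaNum N ξ ζ τ / kappaDen N ξ ζ τ) * th τ ζ / th τ (ξ + ζ)

lemma Zmat_eq {N : ℕ} (hN : 0 < N) (ξ ζ τ : ℂ) :
    Zmat N ξ ζ τ = (cc N ξ ζ τ / N) • AA N τ ζ ξ := by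
  rw [Zmat, AA, sumN, show cc N ξ ζ τ / N = cc N ξ ζ τ * (N : ℂ)⁻¹ from div_eq_mul_inv _ _,
    mul_smul, Finset.smul_sum (r := (N : ℂ)⁻¹)]
  refine congrArg (fun M : Matrix (Fin N × Fin N) (Fin N × Fin N) ℂ => cc N ξ ζ τ • M) (Finset.sum_congr rfl fun α _ => ?_)
  rw [Jm_eq hN, Wcoef_eq, mul_smul, one_div]

lemma gHalf_mul {N : ℕ} (M : Matrix (Fin N × Fin N) (Fin N × Fin N) ℂ) (a b c d : Fin N) :
    ((gHalf N ⊗ₖ gHalf N) * M * (gHalf N ⊗ₖ gHalf N)⁻¹) (a, b) (c, d) =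
      gHalf N a a * gHalf N b b * M (a, b) (c, d) * ((gHalf N c c)⁻¹ * (gHalf N d d)⁻¹) := by
  have e : gHalf N ⊗ₖ gHalf N =
      Matrix.diagonal fun p : Fin N × Fin N => gHalf N p.1 p.1 * gHalf N p.2 p.2 := by
    simp only [gHalf, Matrix.diagonal_kronecker_diagonal, Matrix.diagonal_apply_eq]
  have n0 : ∀ a : Fin N, gHalf N a a ≠ 0 := fun a => by
    simp only [gHalf, Matrix.diagonal_apply_eq]; exact eπ_ne _
  have e' : (gHalf N ⊗ₖ gHalf N)⁻¹ =
      Matrix.diagonal fun p : Fin N × Fin N => (gHalf N p.1 p.1)⁻¹ * (gHalf N p.2 p.2)⁻¹ := by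
    apply Matrix.inv_eq_right_inv
    rw [e, Matrix.diagonal_mul_diagonal, ← Matrix.diagonal_one]
    congr 1; ext p
    have := n0 p.1
    have := n0 p.2
    field_simp
  rw [e', Matrix.mul_diagonal, e, Matrix.diagonal_mul]

/-- conjugation -/
def cj (N : ℕ) (M : Matrix (Fin N × Fin N) (Fin N × Fin N) ℂ) :
    Matrix (Fin N × Fin N) (Fin N × Fin N) ℂ :=
  (gHalf N ⊗ₖ gHalf N) * M * (gHalf N ⊗ₖ gHalf N)⁻¹

lemma gHalf_ne {N : ℕ} (a : Fin N) : gHalf N a a ≠ 0 := by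
  simp only [gHalf, Matrix.diagonal_apply_eq]; exact eπ_ne _

lemma cj_mul {N : ℕ} {M M' : Matrix (Fin N × Fin N) (Fin N × Fin N) ℂ} {t : ℂ}
    (h : M * M' = t • 1) : cj N M * cj N M' = t • 1 := by
  ext ⟨a, b⟩ ⟨c, d⟩
  have h' := congrFun (congrFun h (a, b)) (c, d)
  rw [Matrix.mul_apply] at h' ⊢
  have : ∀ e : Fin N × Fin N, cj N M (a, b) e * cj N M' e (c, d) =
      (gHalf N a a * gHalf N b b * ((gHalf N c c)⁻¹ * (gHalf N d d)⁻¹)) *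
        (M (a, b) e * M' e (c, d)) := by
    rintro ⟨e, f⟩
    rw [cj, cj, gHalf_mul, gHalf_mul]
    have := gHalf_ne e
    have := gHalf_ne f
    field_simp
  simp only [this]
  rw [← Finset.mul_sum, h']
  simp only [Matrix.smul_apply, Matrix.one_apply, Prod.mk.injEq]
  split_ifs with hh
  · obtain ⟨rfl, rfl⟩ := hh
    have := gHalf_ne a
    have := gHalf_ne b
    simp only [smul_eq_mul]
    field_simp
  · simp

lemma pt2_cj_mul {N : ℕ} {M M' : Matrix (Fin N × Fin N) (Fin N × Fin N) ℂ} {t : ℂ}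
    (h : pt2 M * pt2 M' = t • 1) : pt2 (cj N M) * pt2 (cj N M') = t • 1 := by
  ext ⟨a, b⟩ ⟨c, d⟩
  have h' := congrFun (congrFun h (a, b)) (c, d)
  rw [Matrix.mul_apply] at h' ⊢
  have : ∀ e : Fin N × Fin N, pt2 (cj N M) (a, b) e * pt2 (cj N M') e (c, d) =
      (gHalf N a a * gHalf N d d * ((gHalf N c c)⁻¹ * (gHalf N b b)⁻¹)) *
        (pt2 M (a, b) e * pt2 M' e (c, d)) := by
    rintro ⟨e, f⟩
    simp only [pt2, Matrix.of_apply]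
    rw [cj, cj, gHalf_mul, gHalf_mul]
    have := gHalf_ne e
    have := gHalf_ne f
    field_simp
  simp only [this]
  rw [← Finset.mul_sum, h']
  simp only [Matrix.smul_apply, Matrix.one_apply, Prod.mk.injEq]
  split_ifs with hh
  · obtain ⟨rfl, rfl⟩ := hh
    have := gHalf_ne a
    have := gHalf_ne b
    simp only [smul_eq_mul]
    field_simp
  · simp

lemma poch2_step {N : ℕ} (hN : 0 < N) {τ ζ : ℂ} (hτ : 0 < τ.im) (hζ : 0 < ζ.im) (x y : ℂ)
    (h : y = x + 2 * N * ζ) : poch2 (eπ x) (eπ (2 * τ)) (eπ (2 * N * ζ)) =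
      poch1 (eπ x) (eπ (2 * τ)) * poch2 (eπ y) (eπ (2 * τ)) (eπ (2 * N * ζ)) := by
  have hp := norm_p hτ
  have hs : ‖eπ (2 * N * ζ)‖ < 1 := norm_eπ_lt (by
    have : (0 : ℝ) < N := by exact_mod_cast hN
    have e : (2 * (N : ℂ) * ζ).im = 2 * N * ζ.im := by
      rw [show 2 * (N : ℂ) * ζ = ((2 * N : ℝ) : ℂ) * ζ by push_cast; ring, Complex.im_ofReal_mul]
    rw [e]; positivity)
  subst h
  rw [poch2_succ hp hs, eπ_add x]

lemma kappa_prod {N : ℕ} (hN : 0 < N) {τ ζ : ℂ} (hτ : 0 < τ.im) (hζ : 0 < ζ.im) (ξ η : ℂ)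
    (hη : η = ξ + N * ζ) :
    kappaNum N ξ ζ τ * kappaDen N η ζ τ * (pr τ (-ξ) * pr τ η) =
      eπ (2 * ζ - 2 * N * ζ) * kappaNum N η ζ τ * kappaDen N ξ ζ τ *
        (pr τ (ζ + ξ) * pr τ (ζ - η)) := by
  have P := poch2_step hN hτ hζ
  have ex : eπ (-(-ξ)) * eπ (-η) =
      eπ (2 * ζ - 2 * N * ζ) * (eπ (-(ζ + ξ)) * eπ (-(ζ - η))) := by
    rw [← eπ_add, ← eπ_add, ← eπ_add]; congr 1; rw [hη]; ring
  unfold kappaDen kappaNum pr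
  rw [P (2 * ζ + 2 * ξ) (2 * ζ + 2 * η) (by rw [hη]; ring),
    P (2 * τ + (2 * N - 2) * ζ + 2 * ξ) (2 * τ + (2 * N - 2) * ζ + 2 * η) (by rw [hη]; ring),
    P (2 * ζ + 2 * -η) (2 * ζ + 2 * -ξ) (by rw [hη]; ring),
    P (2 * τ + (2 * N - 2) * ζ + 2 * -η) (2 * τ + (2 * N - 2) * ζ + 2 * -ξ) (by rw [hη]; ring),
    P (2 * N * ζ - 2 * η) (2 * N * ζ - 2 * ξ) (by rw [hη]; ring),
    P (2 * τ - 2 * η) (2 * τ - 2 * ξ) (by rw [hη]; ring),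
    P (2 * N * ζ - 2 * -ξ) (2 * N * ζ - 2 * -η) (by rw [hη]; ring),
    P (2 * τ - 2 * -ξ) (2 * τ - 2 * -η) (by rw [hη]; ring)]
  rw [show 2 * (ζ + ξ) = 2 * ζ + 2 * ξ by ring,
    show 2 * (ζ - η) = 2 * ζ + 2 * -η by ring,
    show 2 * τ - (2 * ζ + 2 * -η) = 2 * τ + (2 * N - 2) * ζ + 2 * ξ by rw [hη]; ring,
    show 2 * τ - (2 * ζ + 2 * ξ) = 2 * τ + (2 * N - 2) * ζ + 2 * -η by rw [hη]; ring,
    show 2 * -ξ = 2 * N * ζ - 2 * η by rw [hη]; ring,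
    show 2 * N * ζ - (2 * N * ζ - 2 * η) = 2 * η by ring]
  linear_combination (poch1 (eπ (2 * ζ + 2 * ξ)) (eπ (2 * τ)) *
    poch1 (eπ (2 * τ + (2 * N - 2) * ζ + 2 * ξ)) (eπ (2 * τ)) *
    poch1 (eπ (2 * ζ + 2 * -η)) (eπ (2 * τ)) *
    poch1 (eπ (2 * τ + (2 * N - 2) * ζ + 2 * -η)) (eπ (2 * τ)) *
    poch1 (eπ (2 * N * ζ - 2 * η)) (eπ (2 * τ)) *
    poch1 (eπ (2 * τ - 2 * η)) (eπ (2 * τ)) *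
    poch1 (eπ (2 * η)) (eπ (2 * τ)) *
    poch1 (eπ (2 * τ - (2 * N * ζ - 2 * η))) (eπ (2 * τ)) *
    poch2 (eπ (2 * ζ + 2 * η)) (eπ (2 * τ)) (eπ (2 * N * ζ)) *
    poch2 (eπ (2 * τ + (2 * N - 2) * ζ + 2 * η)) (eπ (2 * τ)) (eπ (2 * N * ζ)) *
    poch2 (eπ (2 * ζ + (2 * N * ζ - 2 * η))) (eπ (2 * τ)) (eπ (2 * N * ζ)) *
    poch2 (eπ (2 * τ + (2 * N - 2) * ζ + (2 * N * ζ - 2 * η))) (eπ (2 * τ)) (eπ (2 * N * ζ)) *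
    poch2 (eπ (2 * N * ζ - 2 * ξ)) (eπ (2 * τ)) (eπ (2 * N * ζ)) *
    poch2 (eπ (2 * τ - 2 * ξ)) (eπ (2 * τ)) (eπ (2 * N * ζ)) *
    poch2 (eπ (2 * N * ζ - 2 * -η)) (eπ (2 * τ)) (eπ (2 * N * ζ)) *
    poch2 (eπ (2 * τ - 2 * -η)) (eπ (2 * τ)) (eπ (2 * N * ζ))) * ex

lemma pr_ne {N : ℕ} (hN : 0 < N) {τ ζ : ℂ} (hτ : 0 < τ.im) (hζ : 0 < ζ.im) (ξ η : ℂ)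
    (hη : η = ξ + N * ζ) (h1 : kappaNum N ξ ζ τ ≠ 0) (h2 : kappaDen N η ζ τ ≠ 0) :
    pr τ (ζ - η) ≠ 0 := by
  have P := poch2_step hN hτ hζ
  unfold kappaDen at h2
  unfold kappaNum at h1 h2
  rw [P (2 * τ + (2 * N - 2) * ζ + 2 * ξ) _ rfl] at h1
  rw [P (2 * ζ + 2 * -η) _ rfl] at h2
  unfold pr
  rw [show 2 * (ζ - η) = 2 * ζ + 2 * -η by ring,
    show 2 * τ - (2 * ζ + 2 * -η) = 2 * τ + (2 * N - 2) * ζ + 2 * ξ by rw [hη]; ring]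
  simp only [mul_ne_zero_iff] at h1 h2 ⊢
  exact ⟨⟨eπ_ne _, h2.1.1.2.1⟩, h1.2.1⟩

lemma scalar_id {N : ℕ} (hN : 0 < N) {τ ζ : ℂ} (hτ : 0 < τ.im) (hζ : 0 < ζ.im) (ξ η : ℂ)
    (hη : η = ξ + N * ζ) (h1 : kappaDen N ξ ζ τ ≠ 0) (h2 : kappaDen N η ζ τ ≠ 0)
    (h3 : th τ (ξ + ζ) ≠ 0) (h4 : th τ (η + ζ) ≠ 0) :
    cc N ξ ζ τ * (th τ ξ * th τ (-η)) = cc N η ζ τ * (th τ (ζ + η) * th τ (ζ - η)) := by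
  obtain ⟨K, hK⟩ := th_eq_pr hτ
  have hNC : (N : ℂ) ≠ 0 := by exact_mod_cast hN.ne'
  have k := kappa_prod hN hτ hζ ξ η hη
  have e : eπ (η * (2 / N - 2)) = eπ (ξ * (2 / N - 2)) * eπ (2 * ζ - 2 * N * ζ) := by
    rw [← eπ_add]; congr 1; rw [hη]; field_simp
  have t : th τ ξ * th τ (-η) = th τ (-ξ) * th τ η := by
    rw [th_neg, th_neg]; ring
  rw [t, cc, cc, e, add_comm ζ η]
  have kth : kappaNum N ξ ζ τ * kappaDen N η ζ τ * (th τ (-ξ) * th τ η) =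
      eπ (2 * ζ - 2 * N * ζ) * kappaNum N η ζ τ * kappaDen N ξ ζ τ *
        (th τ (ξ + ζ) * th τ (ζ - η)) := by
    rw [hK, hK, hK, hK, add_comm ξ ζ]; linear_combination K ^ 2 * k
  generalize eπ (ξ * (2 / N - 2)) = E1 at *
  generalize eπ (2 * ζ - 2 * N * ζ) = E2 at *
  field_simp
  linear_combination E1 * th τ ζ * kth

/-- Crossing-unitarity: `(R(z)^{t₂})⁻¹ = (R(q^N z)⁻¹)^{t₂}`, where `z = eπ ξ`
and `q^N z = eπ (ξ + N ζ)`. -/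
theorem belavin_crossing_unitarity (N : ℕ) (hN : 2 ≤ N) (ξ ζ τ : ℂ)
    (hτ : 0 < τ.im) (hζ : 0 < ζ.im)
    (h1 : Rgeneric N ξ ζ τ) (h2 : Rgeneric N (ξ + N * ζ) ζ τ)
    (hinv1 : IsUnit (pt2 (Rmat N ξ ζ τ))) (hinv2 : IsUnit (Rmat N (ξ + N * ζ) ζ τ)) :
    (pt2 (Rmat N ξ ζ τ))⁻¹ = pt2 ((Rmat N (ξ + N * ζ) ζ τ)⁻¹) := by
  have hN0 : 0 < N := by omega
  have hNC : (N : ℂ) ≠ 0 := by exact_mod_cast hN0.ne'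
  have : Nonempty (Fin N × Fin N) := ⟨(⟨0, hN0⟩, ⟨0, hN0⟩)⟩
  have a1 : th τ (ξ + ζ) ≠ 0 := h1.1
  have a2 : th τ (ξ + N * ζ + ζ) ≠ 0 := h2.1
  have z0 : th τ ζ ≠ 0 := by
    refine th_ne_of_div hN0 hτ a1 (fun α h => h1.2.1 α ?_)
    rw [jTheta_char]
    rw [aa] at h
    push_cast at h ⊢
    rw [show ζ / N + ((α.1 : ℕ) : ℂ) / N * τ + ((α.2 : ℕ) : ℂ) / N =
      ζ / N + (((α.1 : ℕ) : ℂ) * τ + (α.2 : ℕ)) / N by ring, h, mul_zero]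
  have hu : AA N τ ζ (ξ + N * ζ) * BB N τ ζ (-(ξ + N * ζ)) = _ := AA_unit hN0 hτ z0 (ξ + N * ζ)
  have hc := AA_cross hN0 hτ z0 ξ
  have hs := scalar_id hN0 hτ hζ ξ (ξ + N * ζ) rfl h1.2.2 h2.2.2 a1 a2
  have c1 : cc N ξ ζ τ ≠ 0 := by
    intro h
    apply hinv1.ne_zero
    rw [Rmat, Zmat_eq hN0, h, zero_div, zero_smul, mul_zero, zero_mul]
    rfl
  have c2 : cc N (ξ + N * ζ) ζ τ ≠ 0 := by
    intro h
    apply hinv2.ne_zero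
    rw [Rmat, Zmat_eq hN0, h, zero_div, zero_smul, mul_zero, zero_mul]
  have kn : kappaNum N ξ ζ τ ≠ 0 := by
    intro h; apply c1; rw [cc, h]; simp
  have d : th τ (ζ - (ξ + N * ζ)) ≠ 0 := by
    obtain ⟨K, hK⟩ := th_eq_pr hτ
    rw [hK] at z0 ⊢
    exact mul_ne_zero (left_ne_zero_of_mul z0) (pr_ne hN0 hτ hζ ξ _ rfl kn h2.2.2)
  generalize hη : ξ + N * ζ = η at *
  set t : ℂ := cc N η ζ τ / N * ((N : ℂ) ^ 2 * (th τ (ζ + η) * th τ (ζ - η)) / th τ ζ ^ 2) with ht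
  have t0 : t ≠ 0 := by
    rw [add_comm] at a2
    rw [ht]; positivity
  have m1 : Zmat N η ζ τ * BB N τ ζ (-η) = t • 1 := by
    rw [Zmat_eq hN0, smul_mul_assoc, hu, smul_smul]
  have m2 : pt2 (Zmat N ξ ζ τ) * pt2 (BB N τ ζ (-η)) = t • 1 := by
    rw [Zmat_eq hN0, pt2_smul, smul_mul_assoc, hc, smul_smul]
    congr 1
    rw [ht]
    field_simp
    linear_combination hs
  have r1 : Rmat N η ζ τ * cj N (BB N τ ζ (-η)) = t • 1 := cj_mul m1
  have r2 : pt2 (Rmat N ξ ζ τ) * pt2 (cj N (BB N τ ζ (-η))) = t • 1 := pt2_cj_mul m2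
  have i1 : (Rmat N η ζ τ)⁻¹ = t⁻¹ • cj N (BB N τ ζ (-η)) := by
    apply Matrix.inv_eq_right_inv
    rw [mul_smul_comm, r1, smul_smul, inv_mul_cancel₀ t0, one_smul]
  rw [i1]
  apply Matrix.inv_eq_right_inv
  rw [pt2_smul, mul_smul_comm, r2, smul_smul, inv_mul_cancel₀ t0, one_smul]

end
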